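/- Let X ⊆ ℝⁿ be a real analytic set with 0 ∈ X, let u ∈ ℝⁿ \ {0} and w ∈ ℝⁿ. Then w ∈ T²_{0,u}X if and only if there exist ε > 0 and a real-analytic curve γ : (0, ε) → ℝⁿ with γ(t) ∈ X for all t ∈ (0, ε) and γ(t) = t u + (1/2) t² w + o(t²) as t → 0⁺, i.e. (γ(t) − t u)/(t²/2) → w as t → 0⁺. -/

import Mathlib

open Filter Topology

/-- A real analytic set: locally the common zero set of a family of real-analytic
functions. -/
def IsRealAnalyticSet {n : ℕ} (X : Set (Fin n → ℝ)) : Prop :=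
  ∀ p ∈ X, ∃ U : Set (Fin n → ℝ), IsOpen U ∧ p ∈ U ∧
    ∃ F : Set ((Fin n → ℝ) → ℝ),
      (∀ f ∈ F, ∀ x ∈ U, AnalyticAt ℝ f x) ∧
      X ∩ U = {x ∈ U | ∀ f ∈ F, f x = 0}

/-- The geometric directional second-order tangent set `T²_{p,u} X` (real case:
positive parameters `t_k ↓ 0`). -/
def secondTangentSet {n : ℕ} (X : Set (Fin n → ℝ)) (p u : Fin n → ℝ) :
    Set (Fin n → ℝ) :=
  {w | ∃ t : ℕ → ℝ, ∃ W : ℕ → (Fin n → ℝ),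
    (∀ k, 0 < t k) ∧ Tendsto t atTop (𝓝 0) ∧ Tendsto W atTop (𝓝 w) ∧
    ∀ k, p + t k • u + ((1 / 2 : ℝ) * t k ^ 2) • W k ∈ X}

namespace RealAnalytic

section Extension

theorem hasSum_congr_iff {ι M : Type*} [AddCommMonoid M] [TopologicalSpace M] {f g : ι → M} {a : M}
    (h : ∀ i, f i = g i) : HasSum f a ↔ HasSum g a := by rw [funext h]

/-- Extension of multilinear forms on `E × ℝ` to `E × 𝒜`, for a normed algebra `𝒜`. -/
theorem exists_multilinear_extension (E 𝒜 : Type*) [NormedAddCommGroup E] [NormedSpace ℝ E]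
    [NormedRing 𝒜] [NormOneClass 𝒜] [NormedAlgebra ℝ 𝒜] (N : ℕ) :
    ∃ T : ContinuousMultilinearMap ℝ (fun _ : Fin N => E × ℝ) ℝ →
        ContinuousMultilinearMap ℝ (fun _ : Fin N => E × 𝒜) 𝒜,
      (∀ p q, T (p + q) = T p + T q) ∧ (∀ (c : ℝ) p, T (c • p) = c • T p) ∧
      (∀ p, ‖T p‖ ≤ 2 ^ N * ‖p‖) ∧
      (∀ p x Y (ℓ : 𝒜 →ₗ[ℝ] ℝ) (c : ℝ), (∀ A, ℓ (Y * A) = c * ℓ A) →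
        ℓ (T p (fun _ => (x, Y))) = p (fun _ => (x, c)) * ℓ 1) ∧
      (∀ p Y, T p (fun _ => (0, Y)) = p (fun _ => (0, 1)) • Y ^ N) := by
  induction N with
  | zero =>
    refine ⟨fun p => ContinuousMultilinearMap.constOfIsEmpty ℝ _ (p 0 • (1 : 𝒜)), ?_, ?_, ?_, ?_, ?_⟩
    · intro p q; ext; simp [add_smul]
    · intro c p; ext; simp [mul_smul]
    · intro p
      simp [norm_smul]
    · intro p x Y ℓ c h
      simp [Subsingleton.elim (fun _ : Fin 0 => (x, c)) 0]
    · intro p Y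
      simp [Subsingleton.elim (fun _ : Fin 0 => ((0 : E), (1 : ℝ))) 0]
  | succ N ih =>
    obtain ⟨T, Tadd, Tsmul, Tn, T1, T2⟩ := ih
    let T' : ContinuousMultilinearMap ℝ (fun _ : Fin N => E × ℝ) ℝ →L[ℝ]
        ContinuousMultilinearMap ℝ (fun _ : Fin N => E × 𝒜) 𝒜 :=
      LinearMap.mkContinuous ⟨⟨T, Tadd⟩, Tsmul⟩ (2 ^ N) Tn
    let M : ContinuousMultilinearMap ℝ (fun _ : Fin N => E × 𝒜) 𝒜 → 𝒜 →L[ℝ]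
        ContinuousMultilinearMap ℝ (fun _ : Fin N => E × 𝒜) 𝒜 := fun q =>
      LinearMap.mkContinuous
        { toFun := fun Y => (ContinuousLinearMap.mul ℝ 𝒜 Y).compContinuousMultilinearMap q
          map_add' := fun a b => by ext; simp
          map_smul' := fun a b => by ext; simp } ‖q‖ (fun Y => by
            refine ContinuousMultilinearMap.opNorm_le_bound (by positivity) fun m => ?_
            simp only [LinearMap.coe_mk, AddHom.coe_mk,
              ContinuousLinearMap.compContinuousMultilinearMap_coe, Function.comp_apply,
              ContinuousLinearMap.mul_apply']
            calc ‖Y * q m‖ ≤ ‖Y‖ * ‖q m‖ := norm_mul_le _ _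
              _ ≤ ‖Y‖ * (‖q‖ * ∏ i, ‖m i‖) := by gcongr; exact q.le_opNorm m
              _ = _ := by ring)
    have hM : ∀ q Y m, M q Y m = Y * q m := fun q Y m => rfl
    have nM : ∀ q Y, ‖M q Y‖ ≤ ‖q‖ * ‖Y‖ := fun q Y => by
      refine ContinuousMultilinearMap.opNorm_le_bound (by positivity) fun m => ?_
      rw [hM]
      calc ‖Y * q m‖ ≤ ‖Y‖ * ‖q m‖ := norm_mul_le _ _
        _ ≤ ‖Y‖ * (‖q‖ * ∏ i, ‖m i‖) := by gcongr; exact q.le_opNorm m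
        _ = _ := by ring
    let S : ContinuousMultilinearMap ℝ (fun _ : Fin (N + 1) => E × ℝ) ℝ →
        ((E × 𝒜) →L[ℝ] ContinuousMultilinearMap ℝ (fun _ : Fin N => E × 𝒜) 𝒜) := fun p =>
      (T' ∘L p.curryLeft ∘L ContinuousLinearMap.inl ℝ E ℝ) ∘L ContinuousLinearMap.fst ℝ E 𝒜 +
        (M (T' (p.curryLeft (0, 1)))) ∘L ContinuousLinearMap.snd ℝ E 𝒜
    have hS : ∀ p (z : E × 𝒜) m, S p z m =
        T (p.curryLeft (z.1, 0)) m + z.2 * T (p.curryLeft (0, 1)) m := fun p z m => rfl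
    refine ⟨fun p => (S p).uncurryLeft, ?_, ?_, ?_, ?_, ?_⟩
    · intro p q
      ext z
      simp only [ContinuousLinearMap.uncurryLeft_apply, hS, add_apply]
      have : (p + q).curryLeft = p.curryLeft + q.curryLeft := rfl
      simp [this, Tadd, mul_add]
      abel
    · intro c p
      ext z
      simp only [ContinuousLinearMap.uncurryLeft_apply, hS, smul_apply]
      have : (c • p).curryLeft = c • p.curryLeft := rfl
      simp [this, Tsmul]
    · intro p
      rw [ContinuousLinearMap.uncurryLeft_norm]
      refine ContinuousLinearMap.opNorm_le_bound _ (by positivity) fun z => ?_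
      have hS' : S p z = T (p.curryLeft (z.1, 0)) + M (T (p.curryLeft (0, 1))) z.2 := by
        ext m; simp [hS, hM]
      have h1 : ‖T (p.curryLeft (z.1, 0))‖ ≤ 2 ^ N * (‖p‖ * ‖z‖) := by
        refine (Tn _).trans ?_
        gcongr
        refine (p.curryLeft.le_opNorm _).trans ?_
        rw [ContinuousMultilinearMap.curryLeft_norm]
        gcongr
        simp [Prod.norm_def]
      have h2 : ‖T (p.curryLeft (0, 1))‖ ≤ 2 ^ N * ‖p‖ := by
        refine (Tn _).trans ?_
        gcongr
        refine (p.curryLeft.le_opNorm _).trans ?_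
        rw [ContinuousMultilinearMap.curryLeft_norm]
        simp [Prod.norm_def]
      calc ‖S p z‖ ≤ ‖T (p.curryLeft (z.1, 0))‖ + ‖M (T (p.curryLeft (0, 1))) z.2‖ := by
            rw [hS']; exact norm_add_le (T (p.curryLeft (z.1, 0))) (M (T (p.curryLeft (0, 1))) z.2)
        _ ≤ 2 ^ N * (‖p‖ * ‖z‖) + (2 ^ N * ‖p‖) * ‖z‖ :=
            add_le_add h1 ((nM _ _).trans (mul_le_mul h2 (le_max_right _ _) (norm_nonneg _)
              (by positivity)))
        _ = _ := by ring
    · intro p x Y ℓ c h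
      rw [ContinuousLinearMap.uncurryLeft_apply, hS, map_add, h]
      have : (Fin.tail fun _ : Fin (N + 1) => (x, Y)) = fun _ => (x, Y) := rfl
      rw [this, T1 _ x Y ℓ c h, T1 _ x Y ℓ c h]
      have e : ((fun _ => (x, c)) : Fin (N + 1) → E × ℝ) =
          Fin.cons (x, c) (fun _ => (x, c)) := by
        ext i <;> refine Fin.cases ?_ (fun j => ?_) i <;> simp
      have e2 : p (fun _ => (x, c)) = p.curryLeft (x, c) (fun _ => (x, c)) := by
        rw [ContinuousMultilinearMap.curryLeft_apply, ← e]
      have e3 : ((x, c) : E × ℝ) = (x, 0) + c • (0, 1) := by simp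
      have e4 : p.curryLeft (x, c) = p.curryLeft (x, 0) + c • p.curryLeft (0, 1) := by
        rw [← map_smul, ← map_add, ← e3]
      rw [e2, e4]
      simp only [add_apply, smul_apply, smul_eq_mul]
      ring
    · intro p Y
      rw [ContinuousLinearMap.uncurryLeft_apply, hS]
      have : (Fin.tail fun _ : Fin (N + 1) => ((0 : E), Y)) = fun _ => (0, Y) := rfl
      rw [this, T2, T2]
      have e : ((fun _ => (0, 1)) : Fin (N + 1) → E × ℝ) =
          Fin.cons (0, 1) (fun _ => (0, 1)) := by
        ext i <;> refine Fin.cases ?_ (fun j => ?_) i <;> simp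
      have e2 : p (fun _ => (0, 1)) = p.curryLeft (0, 1) (fun _ => (0, 1)) := by
        rw [ContinuousMultilinearMap.curryLeft_apply, ← e]
      have e3 : p.curryLeft ((0 : E), (0 : ℝ)) = 0 := by
        rw [show ((0 : E), (0 : ℝ)) = 0 from rfl, map_zero]
      rw [e2, e3]
      simp [pow_succ']

/-- An analytic germ on `E × ℝ` extends to an analytic map on `E × 𝒜`, compatibly with
eigenfunctionals. -/
theorem exists_analytic_extension {E : Type*} [NormedAddCommGroup E] [NormedSpace ℝ E] (𝒜 : Type*)
    [NormedRing 𝒜] [NormOneClass 𝒜] [NormedAlgebra ℝ 𝒜] [CompleteSpace 𝒜] {f : E × ℝ → ℝ}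
    (hf : AnalyticAt ℝ f 0) :
    ∃ R > (0 : ℝ), ∃ C : ℝ, ∃ F : E × 𝒜 → 𝒜, ∃ a : ℕ → ℝ, (∀ z, ‖z‖ < R → AnalyticAt ℝ F z) ∧
      (∀ x Y (ℓ : 𝒜 →L[ℝ] ℝ) (c : ℝ), ‖x‖ < R → ‖Y‖ < R → |c| < R →
        (∀ A, ℓ (Y * A) = c * ℓ A) → ℓ (F (x, Y)) = f (x, c) * ℓ 1) ∧
      (∀ N, |a N| * R ^ N ≤ C) ∧
      (∀ Y, ‖Y‖ < R → HasSum (fun N => a N • Y ^ N) (F (0, Y))) ∧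
      (∀ c, |c| < R → HasSum (fun N => a N * c ^ N) (f (0, c))) := by
  obtain ⟨p, r, hp⟩ := hf
  obtain ⟨r0, hr0, hr0r⟩ := ENNReal.lt_iff_exists_nnreal_btwn.1 hp.r_pos
  have hr0' : 0 < r0 := by exact_mod_cast hr0
  choose T Tadd Tsmul Tn T1 T2 using fun N => exists_multilinear_extension E 𝒜 N
  obtain ⟨C, hC0, hC⟩ := p.norm_mul_pow_le_of_lt_radius (lt_of_lt_of_le hr0r hp.r_le)
  let q : FormalMultilinearSeries ℝ (E × 𝒜) 𝒜 := fun N => T N (p N)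
  have hq : ((r0 / 2 : NNReal) : ENNReal) ≤ q.radius := by
    refine q.le_radius_of_bound C fun N => ?_
    calc ‖q N‖ * ((r0 / 2 : NNReal) : ℝ) ^ N ≤ (2 ^ N * ‖p N‖) * ((r0 / 2 : NNReal) : ℝ) ^ N := by
          gcongr; exact Tn N _
      _ = ‖p N‖ * (r0 : ℝ) ^ N := by push_cast; rw [div_pow]; field_simp
      _ ≤ C := hC N
  have hqp : 0 < q.radius := lt_of_lt_of_le (by exact_mod_cast half_pos hr0') hq
  have hF := q.hasFPowerSeriesOnBall hqp
  have hball : ∀ z : E × 𝒜, ‖z‖ < r0 / 2 → z ∈ Metric.eball (0 : E × 𝒜) q.radius := by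
    intro z hz
    refine Metric.eball_subset_eball hq ?_
    rw [Metric.mem_eball, edist_eq_enorm_sub, sub_zero, enorm_eq_nnnorm, ENNReal.coe_lt_coe,
      ← NNReal.coe_lt_coe]
    exact hz
  have hball' : ∀ z : E × ℝ, ‖z‖ < r0 → z ∈ Metric.eball (0 : E × ℝ) r := by
    intro z hz
    refine Metric.eball_subset_eball hr0r.le ?_
    rw [Metric.mem_eball, edist_eq_enorm_sub, sub_zero, enorm_eq_nnnorm, ENNReal.coe_lt_coe,
      ← NNReal.coe_lt_coe]
    exact hz
  have hr0R : (0 : ℝ) < r0 := hr0'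
  refine ⟨r0 / 2, by positivity, C, q.sum, fun N => p N (fun _ => (0, 1)), ?_, ?_, ?_, ?_, ?_⟩
  · intro z hz
    exact hF.analyticAt_of_mem (hball z hz)
  · intro x Y ℓ c hx hY hc h
    have h1 := (hF.hasSum (hball (x, Y) (by simp [Prod.norm_def, hx, hY]))).mapL ℓ
    have hc' : ‖c‖ < r0 := by rw [Real.norm_eq_abs]; linarith
    have h2 := (hp.hasSum (hball' (x, c) (by simp only [Prod.norm_def, sup_lt_iff]; exact ⟨by linarith, hc'⟩))).mul_right (ℓ 1)
    rw [zero_add] at h1 h2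
    exact h1.unique ((hasSum_congr_iff fun N => T1 N (p N) x Y ℓ c h).2 h2)
  · intro N
    refine le_trans ?_ (hC N)
    gcongr
    · refine ((p N).le_opNorm _).trans ?_
      simp [Prod.norm_def]
    · linarith
  · intro Y hY
    have h1 := hF.hasSum (hball (0, Y) (by simpa [Prod.norm_def] using hY))
    rw [zero_add] at h1
    exact (hasSum_congr_iff fun N => T2 N (p N) Y).1 h1
  · intro c hc
    have hc' : ‖c‖ < r0 := by rw [Real.norm_eq_abs]; linarith
    have h1 := hp.hasSum (hball' (0, c) (by simpa [Prod.norm_def] using hc'))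
    rw [zero_add] at h1
    refine (hasSum_congr_iff fun N => ?_).1 h1
    have : (fun _ : Fin N => ((0 : E), c)) = fun i => c • ((0 : E), (1 : ℝ)) := by simp
    rw [this, (p N).map_smul_univ (fun _ => c) (fun _ => (0, 1))]
    simp [mul_comm]

end Extension

section Shift

/-- Bounded real sequences. -/
def BddSeq : Type := BoundedContinuousFunction ℕ ℝ

noncomputable instance : NormedAddCommGroup BddSeq :=
  inferInstanceAs (NormedAddCommGroup (BoundedContinuousFunction ℕ ℝ))
noncomputable instance : NormedSpace ℝ BddSeq :=
  inferInstanceAs (NormedSpace ℝ (BoundedContinuousFunction ℕ ℝ))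
instance : CompleteSpace BddSeq :=
  inferInstanceAs (CompleteSpace (BoundedContinuousFunction ℕ ℝ))

/-- The coordinate functionals on bounded sequences. -/
noncomputable def coord (j : ℕ) : BddSeq →L[ℝ] ℝ := BoundedContinuousFunction.evalCLM ℝ j

/-- The bounded sequence with given terms and bound. -/
noncomputable def mkSeq (s : ℕ → ℝ) (C : ℝ) (h : ∀ n, ‖s n‖ ≤ C) : BddSeq :=
  BoundedContinuousFunction.ofNormedAddCommGroupDiscrete s C h

@[simp] theorem coord_mkSeq (s : ℕ → ℝ) (C : ℝ) (h : ∀ n, ‖s n‖ ≤ C) (j : ℕ) :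
    coord j (mkSeq s C h) = s j := rfl

theorem BddSeq.ext_coord {a b : BddSeq} (h : ∀ j, coord j a = coord j b) : a = b :=
  BoundedContinuousFunction.ext h

theorem norm_coord_le (j : ℕ) (s : BddSeq) : ‖coord j s‖ ≤ ‖s‖ :=
  BoundedContinuousFunction.norm_coe_le_norm (α := ℕ) (β := ℝ) s j

theorem BddSeq.norm_le_of_coord {s : BddSeq} {C : ℝ} (hC : 0 ≤ C) (h : ∀ j, ‖coord j s‖ ≤ C) :
    ‖s‖ ≤ C :=
  (BoundedContinuousFunction.norm_le (α := ℕ) (β := ℝ) hC).2 h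

/-- The left shift on bounded sequences. -/
noncomputable def shiftL : BddSeq →L[ℝ] BddSeq :=
  LinearMap.mkContinuous
    { toFun := fun s => mkSeq (fun n => coord (n + 1) s) ‖s‖ (fun n => norm_coord_le _ s)
      map_add' := fun a b => BddSeq.ext_coord fun n => by simp
      map_smul' := fun a b => BddSeq.ext_coord fun n => by simp } 1
    (fun s => by
      rw [one_mul]
      exact BddSeq.norm_le_of_coord (norm_nonneg _) fun n => norm_coord_le _ s)

/-- The right shift on bounded sequences. -/
noncomputable def shiftR : BddSeq →L[ℝ] BddSeq :=
  LinearMap.mkContinuous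
    { toFun := fun s => mkSeq (fun n => Nat.casesOn n 0 fun k => coord k s) ‖s‖
        (fun n => by cases n with
          | zero => simp
          | succ k => exact norm_coord_le _ s)
      map_add' := fun a b => BddSeq.ext_coord fun n => by cases n <;> simp
      map_smul' := fun a b => BddSeq.ext_coord fun n => by cases n <;> simp } 1
    (fun s => by
      rw [one_mul]
      refine BddSeq.norm_le_of_coord (norm_nonneg _) fun n => ?_
      cases n with
        | zero => simp
        | succ k => exact norm_coord_le _ s)

/-- The first basis sequence. -/
noncomputable def seqOne : BddSeq :=
  mkSeq (fun n => if n = 0 then 1 else 0) 1 (fun n => by split_ifs <;> simp)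

instance : Nontrivial BddSeq :=
  ⟨⟨0, seqOne, fun h => by simpa [seqOne] using congrArg (coord 0) h⟩⟩

@[simp] theorem coord_shiftL (s : BddSeq) (n : ℕ) : coord n (shiftL s) = coord (n + 1) s := rfl
@[simp] theorem coord_zero_shiftR (s : BddSeq) : coord 0 (shiftR s) = 0 := rfl
@[simp] theorem coord_succ_shiftR (s : BddSeq) (n : ℕ) :
    coord (n + 1) (shiftR s) = coord n s := rfl

theorem shiftL_shiftR (s : BddSeq) : shiftL (shiftR s) = s := BddSeq.ext_coord fun _ => rfl

theorem shiftL_seqOne : shiftL seqOne = 0 := BddSeq.ext_coord fun n => by simp [seqOne]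

theorem norm_shiftL_le : ‖shiftL‖ ≤ 1 := LinearMap.mkContinuous_norm_le _ zero_le_one _
theorem norm_shiftR_le : ‖shiftR‖ ≤ 1 := LinearMap.mkContinuous_norm_le _ zero_le_one _

theorem coord_shiftL_pow (d : ℕ) (s : BddSeq) (n : ℕ) :
    coord n ((shiftL ^ d) s) = coord (n + d) s := by
  induction d generalizing s n with
  | zero => simp
  | succ d ih => rw [pow_succ, mul_apply_eq_comp, ih, coord_shiftL]; rfl

/-- Evaluation of the power series with given bounded coefficients. -/
noncomputable def evalSeq (y : ℝ) : BddSeq →L[ℝ] ℝ :=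
  (coord 0).comp (Ring.inverse (1 - y • shiftL))

theorem isUnit_one_sub_smul_shiftL {y : ℝ} (hy : |y| < 1) : IsUnit (1 - y • shiftL) := by
  refine isUnit_one_sub_of_norm_lt_one ?_
  rw [norm_smul]
  calc ‖y‖ * ‖shiftL‖ ≤ |y| * 1 := by gcongr; exacts [le_rfl, norm_shiftL_le]
    _ < 1 := by simpa

theorem evalSeq_apply {y : ℝ} (hy : |y| < 1) (s : BddSeq) :
    evalSeq y s = coord 0 s + y * evalSeq y (shiftL s) := by
  have h := Ring.inverse_mul_cancel _ (isUnit_one_sub_smul_shiftL hy)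
  have h2 := congrArg (fun A : BddSeq →L[ℝ] BddSeq => coord 0 (A s)) h
  simp only [mul_apply_eq_comp, sub_apply, one_apply_eq_self, smul_apply, map_sub,
    map_smul, smul_eq_mul] at h2
  simp only [evalSeq, ContinuousLinearMap.comp_apply]
  linarith

theorem evalSeq_shiftR {y : ℝ} (hy : |y| < 1) (s : BddSeq) :
    evalSeq y (shiftR s) = y * evalSeq y s := by
  rw [evalSeq_apply hy, coord_zero_shiftR, shiftL_shiftR, zero_add]

theorem evalSeq_shiftR_pow {y : ℝ} (hy : |y| < 1) (d : ℕ) (s : BddSeq) :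
    evalSeq y ((shiftR ^ d) s) = y ^ d * evalSeq y s := by
  induction d with
  | zero => simp
  | succ d ih =>
    rw [pow_succ', mul_apply_eq_comp, evalSeq_shiftR hy, ih, pow_succ']; ring

theorem evalSeq_seqOne {y : ℝ} (hy : |y| < 1) : evalSeq y seqOne = 1 := by
  rw [evalSeq_apply hy, shiftL_seqOne, map_zero, mul_zero, add_zero]
  simp [seqOne]

theorem evalSeq_eq_sum {y : ℝ} (hy : |y| < 1) (d : ℕ) (s : BddSeq) :
    evalSeq y s =
      ∑ j ∈ Finset.range d, coord j s * y ^ j + y ^ d * evalSeq y ((shiftL ^ d) s) := by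
  induction d with
  | zero => simp
  | succ d ih =>
    rw [ih, evalSeq_apply hy, Finset.sum_range_succ, coord_shiftL_pow, pow_succ' shiftL,
      mul_apply_eq_comp, zero_add]
    ring

theorem analyticAt_evalSeq {y : ℝ} (hy : |y| < 1) : AnalyticAt ℝ evalSeq y := by
  have h1 : AnalyticAt ℝ (fun y : ℝ => 1 - y • shiftL) y :=
    analyticAt_const.sub (analyticAt_id.smul analyticAt_const)
  obtain ⟨v, hv⟩ := isUnit_one_sub_smul_shiftL hy
  have h2 : AnalyticAt ℝ (Ring.inverse : (BddSeq →L[ℝ] BddSeq) → _) (1 - y • shiftL) := by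
    rw [← hv]; exact analyticAt_inverse v
  have h3 := AnalyticAt.comp (f := fun y : ℝ => 1 - y • shiftL) h2 h1
  exact ((ContinuousLinearMap.compL ℝ BddSeq BddSeq ℝ (coord 0)).analyticAt _).comp h3

end Shift

section Division

variable {E : Type*} [NormedAddCommGroup E] [NormedSpace ℝ E]

theorem norm_smul_shiftR_lt {r R : ℝ} (hr : 0 < r) (hrR : r < R) : ‖r • shiftR‖ < R := by
  rw [norm_smul, Real.norm_of_nonneg hr.le]
  calc r * ‖shiftR‖ ≤ r * 1 := by gcongr; exact norm_shiftR_le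
    _ < R := by simpa

theorem abs_div_lt_one {y r : ℝ} (hr : 0 < r) (hy : |y| < r) : |y / r| < 1 := by
  rw [abs_div, abs_of_pos hr, div_lt_one hr]; exact hy

theorem evalSeq_smul_shiftR_mul {r y : ℝ} (hr : 0 < r) (hy : |y| < r) (s : BddSeq)
    (A : BddSeq →L[ℝ] BddSeq) :
    evalSeq (y / r) (((r • shiftR) * A) s) = y * evalSeq (y / r) (A s) := by
  rw [mul_apply_eq_comp, smul_apply, map_smul, evalSeq_shiftR (abs_div_lt_one hr hy), smul_eq_mul]
  field_simp

/-- An analytic germ as a power series in the last variable with coefficients analytic in the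
others. -/
theorem exists_bddSeq_expansion {f : E × ℝ → ℝ} (hf : AnalyticAt ℝ f 0) :
    ∃ R > (0 : ℝ), ∃ C : ℝ, ∃ F : E × (BddSeq →L[ℝ] BddSeq) → (BddSeq →L[ℝ] BddSeq), ∃ a : ℕ → ℝ,
      (∀ z, ‖z‖ < R → AnalyticAt ℝ F z) ∧
      (∀ r, 0 < r → r < R → ∀ x y s, ‖x‖ < R → |y| < r →
        evalSeq (y / r) (F (x, r • shiftR) s) = f (x, y) * evalSeq (y / r) s) ∧
      (∀ N, |a N| * R ^ N ≤ C) ∧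
      (∀ r, 0 < r → r < R → HasSum (fun N => (a N * r ^ N) • shiftR ^ N) (F (0, r • shiftR))) ∧
      (∀ c, |c| < R → HasSum (fun N => a N * c ^ N) (f (0, c))) := by
  obtain ⟨R, hR, C, F, a, h1, h2, h3, h4, h5⟩ :=
    exists_analytic_extension (BddSeq →L[ℝ] BddSeq) hf
  refine ⟨R, hR, C, F, a, h1, ?_, h3, ?_, h5⟩
  · intro r hr hrR x y s hx hy
    have := h2 x (r • shiftR) ((evalSeq (y / r)).comp (ContinuousLinearMap.apply ℝ BddSeq s)) y hx
      (norm_smul_shiftR_lt hr hrR) (hy.trans hrR)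
      (fun A => evalSeq_smul_shiftR_mul hr hy s A)
    exact this
  · intro r hr hrR
    refine (hasSum_congr_iff fun N => ?_).1 (h4 _ (norm_smul_shiftR_lt hr hrR))
    rw [smul_pow, smul_smul]

theorem analyticAt_prodMk_left {F : Type*} [NormedAddCommGroup F] [NormedSpace ℝ F] (x : E) (y : F) :
    AnalyticAt ℝ (fun x : E => (x, y)) x := analyticAt_id.prod analyticAt_const

theorem analyticAt_clm_apply {F G : Type*} [NormedAddCommGroup F] [NormedSpace ℝ F]
    [NormedAddCommGroup G] [NormedSpace ℝ G] {A : E → F →L[ℝ] G} {s : E → F} {x : E}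
    (hA : AnalyticAt ℝ A x) (hs : AnalyticAt ℝ s x) : AnalyticAt ℝ (fun x => A x (s x)) x :=
  AnalyticAt.comp (f := fun x => (A x, s x))
    ((ContinuousLinearMap.id ℝ (F →L[ℝ] G)).analyticAt_bilinear (A x, s x)) (hA.prod hs)

theorem eventually_norm_lt {E : Type*} [SeminormedAddCommGroup E] {R : ℝ} (hR : 0 < R) :
    ∀ᶠ x in 𝓝 (0 : E), ‖x‖ < R := by
  filter_upwards [Metric.ball_mem_nhds (0 : E) hR] with x hx using by simpa using hx

theorem exists_scale {R R' C : ℝ} (hR : 0 < R) (hR' : 0 < R') {a : ℕ → ℝ} {d : ℕ} (hd : a d ≠ 0)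
    (hlt : ∀ j < d, a j = 0) (F3 : ∀ N, |a N| * R ^ N ≤ C) {F : ℝ → (BddSeq →L[ℝ] BddSeq)}
    (F4 : ∀ r, 0 < r → r < R → HasSum (fun N => (a N * r ^ N) • shiftR ^ N) (F r)) :
    ∃ r, 0 < r ∧ r < R ∧ r < R' ∧ ‖F r - (a d * r ^ d) • shiftR ^ d‖ < |a d * r ^ d| := by
  set K := |a d| * R ^ d with hK
  have hK0 : 0 < K := by positivity
  have hC0 : 0 ≤ C := hK0.le.trans (F3 d)
  obtain ⟨r, hr, hrR, hrR', hrK⟩ : ∃ r, 0 < r ∧ r < R ∧ r < R' ∧ C * (r / R) < K * (1 - r / R) := by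
    have ht : Tendsto (fun r : ℝ => C * (r / R) - K * (1 - r / R)) (𝓝[>] 0)
        (𝓝 (C * (0 / R) - K * (1 - 0 / R))) := by
      refine tendsto_nhdsWithin_of_tendsto_nhds (Continuous.tendsto ?_ 0)
      fun_prop
    have h1 := ht.eventually_lt_const (u := 0) (by simpa using hK0)
    have h2 : ∀ᶠ r in 𝓝[>] (0 : ℝ), r ∈ Set.Ioo 0 (min R R') :=
      Ioo_mem_nhdsGT (lt_min hR hR')
    obtain ⟨r, h3, h4, h5⟩ := (h1.and h2).exists
    exact ⟨r, h4, h5.trans_le (min_le_left _ _), h5.trans_le (min_le_right _ _), by linarith⟩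
  set q := r / R with hq
  have hq0 : 0 < q := by positivity
  have hq1 : q < 1 := (div_lt_one hR).2 hrR
  have hrq : r = R * q := by rw [hq]; field_simp
  refine ⟨r, hr, hrR, hrR', ?_⟩
  have hs := (hasSum_nat_add_iff' (d + 1)).2 (F4 r hr hrR)
  have hsum : ∑ i ∈ Finset.range (d + 1), (a i * r ^ i) • shiftR ^ i =
      (a d * r ^ d) • shiftR ^ d := by
    rw [Finset.sum_range_succ, Finset.sum_eq_zero, zero_add]
    intro i hi
    rw [hlt i (Finset.mem_range.1 hi), zero_mul, zero_smul]
  rw [hsum] at hs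
  have hg : HasSum (fun n : ℕ => C * q ^ (d + 1) * q ^ n) (C * q ^ (d + 1) * (1 - q)⁻¹) :=
    (hasSum_geometric_of_lt_one hq0.le hq1).mul_left _
  have hb : ∀ n : ℕ, ‖(a (n + (d + 1)) * r ^ (n + (d + 1))) • shiftR ^ (n + (d + 1))‖ ≤
      C * q ^ (d + 1) * q ^ n := by
    intro n
    have e1 : ‖shiftR ^ (n + (d + 1))‖ ≤ 1 :=
      (norm_pow_le _ _).trans (pow_le_one₀ (norm_nonneg _) norm_shiftR_le)
    calc _ ≤ ‖a (n + (d + 1)) * r ^ (n + (d + 1))‖ * 1 := by rw [norm_smul]; gcongr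
      _ = (|a (n + (d + 1))| * R ^ (n + (d + 1))) * q ^ (n + (d + 1)) := by
        rw [mul_one, Real.norm_eq_abs, abs_mul, abs_of_pos (pow_pos hr _), hrq, mul_pow, mul_assoc]
      _ ≤ C * q ^ (n + (d + 1)) := by gcongr; exact F3 _
      _ = _ := by rw [pow_add q n]; ring
  have := hs.norm_le_of_bounded hg hb
  refine this.trans_lt ?_
  rw [abs_mul, abs_of_pos (pow_pos hr d), hrq, mul_pow, ← mul_assoc, ← hK, ← div_eq_mul_inv,
    div_lt_iff₀ (by linarith), pow_succ]
  calc C * (q ^ d * q) = (C * q) * q ^ d := by ring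
    _ < (K * (1 - q)) * q ^ d := by gcongr
    _ = _ := by ring

/-- Weierstrass division. -/
theorem exists_division {f : E × ℝ → ℝ} (hf : AnalyticAt ℝ f 0)
    (hf0 : ¬ ∀ᶠ y in 𝓝 (0 : ℝ), f (0, y) = 0) :
    ∃ d : ℕ, ∀ h : E × ℝ → ℝ, AnalyticAt ℝ h 0 → ∃ r : ℕ → E → ℝ,
      (∀ j, AnalyticAt ℝ (r j) 0) ∧
      ∀ᶠ z in 𝓝 (0 : E × ℝ), f z = 0 → h z = ∑ j ∈ Finset.range d, r j z.1 * z.2 ^ j := by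
  obtain ⟨R, hR, C, F, a, F1, F2, F3, F4, F5⟩ := exists_bddSeq_expansion hf
  have hex : ∃ d, a d ≠ 0 := by
    by_contra! hcon
    refine hf0 ?_
    filter_upwards [Metric.ball_mem_nhds (0 : ℝ) hR] with y hy
    have := F5 y (by simpa using hy)
    simp only [hcon, zero_mul] at this
    exact this.unique hasSum_zero
  classical
  let d := Nat.find hex
  have hd : a d ≠ 0 := Nat.find_spec hex
  have hlt : ∀ j < d, a j = 0 := fun j hj => by_contra fun h => Nat.find_min hex hj h
  refine ⟨d, fun h hh => ?_⟩
  obtain ⟨R', hR', C', H, -, H1, H2, -⟩ := exists_bddSeq_expansion hh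
  obtain ⟨r, hr, hrR, hrR', hnorm⟩ := exists_scale (F := fun r => F (0, r • shiftR)) hR hR' hd hlt F3 F4
  set α := a d * r ^ d with hα
  have hα0 : α ≠ 0 := mul_ne_zero hd (pow_pos hr _).ne'
  let T : E → (BddSeq →L[ℝ] BddSeq) := fun x =>
    α⁻¹ • (F (x, r • shiftR) * shiftL ^ d) + (1 - shiftR ^ d * shiftL ^ d)
  have hY : ‖((0 : E), r • shiftR)‖ < R := by
    simpa [Prod.norm_def, hR] using norm_smul_shiftR_lt hr hrR
  have hY' : ‖((0 : E), r • shiftR)‖ < R' := by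
    simpa [Prod.norm_def, hR'] using norm_smul_shiftR_lt hr hrR'
  have hFx : AnalyticAt ℝ (fun x : E => F (x, r • shiftR)) 0 :=
    AnalyticAt.comp (f := fun x : E => (x, r • shiftR)) (F1 _ hY) (analyticAt_prodMk_left _ _)
  have hHx : AnalyticAt ℝ (fun x : E => H (x, r • shiftR)) 0 :=
    AnalyticAt.comp (f := fun x : E => (x, r • shiftR)) (H1 _ hY') (analyticAt_prodMk_left _ _)
  have hT1 : AnalyticAt ℝ (fun x : E => F (x, r • shiftR) * shiftL ^ d) 0 :=
    hFx.fun_mul analyticAt_const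
  have hT2 : AnalyticAt ℝ (fun x : E => α⁻¹ • (F (x, r • shiftR) * shiftL ^ d)) 0 :=
    hT1.fun_const_smul
  have hT : AnalyticAt ℝ T 0 := hT2.fun_add analyticAt_const
  have hT0 : IsUnit (T 0) := by
    have e : T 0 = 1 - (-(α⁻¹ • ((F (0, r • shiftR) - α • shiftR ^ d) * shiftL ^ d))) := by
      simp only [T, sub_mul, smul_sub, smul_mul_assoc, smul_smul, inv_mul_cancel₀ hα0, one_smul]
      abel
    rw [e]
    refine isUnit_one_sub_of_norm_lt_one ?_
    rw [norm_neg, norm_smul, norm_inv, Real.norm_eq_abs, inv_mul_lt_iff₀ (abs_pos.2 hα0), mul_one]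
    refine lt_of_le_of_lt (norm_mul_le _ _) (lt_of_le_of_lt ?_ hnorm)
    refine mul_le_of_le_one_right (norm_nonneg _) ?_
    exact (norm_pow_le _ _).trans (pow_le_one₀ (norm_nonneg _) norm_shiftL_le)
  have hTi : AnalyticAt ℝ (fun x => Ring.inverse (T x)) 0 := by
    obtain ⟨v, hv⟩ := hT0
    have h2 : AnalyticAt ℝ (Ring.inverse : (BddSeq →L[ℝ] BddSeq) → BddSeq →L[ℝ] BddSeq) (T 0) := by
      rw [← hv]; exact analyticAt_inverse v
    exact AnalyticAt.comp (f := T) h2 hT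
  let b : E → BddSeq := fun x => (Ring.inverse (T x) * H (x, r • shiftR)) seqOne
  have hb : AnalyticAt ℝ b 0 :=
    analyticAt_clm_apply (hTi.fun_mul hHx) analyticAt_const
  refine ⟨fun j x => (r ^ j)⁻¹ * coord j (b x), fun j => ?_, ?_⟩
  · exact analyticAt_const.fun_mul (analyticAt_clm_apply (A := fun _ => coord j) analyticAt_const hb)
  have hU : ∀ᶠ x in 𝓝 (0 : E), IsUnit (T x) :=
    hT.continuousAt.eventually (Units.isOpen.mem_nhds hT0)
  have hx : ∀ᶠ x in 𝓝 (0 : E), ‖x‖ < min R R' := eventually_norm_lt (lt_min hR hR')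
  have hy : ∀ᶠ y in 𝓝 (0 : ℝ), |y| < r := eventually_norm_lt (E := ℝ) hr
  have := (hU.and hx).prod_nhds hy
  rw [show ((0 : E), (0 : ℝ)) = 0 from rfl] at this
  filter_upwards [this] with ⟨x, y⟩ ⟨⟨hxU, hxn⟩, hyr⟩ hfz
  simp only at hxU hxn hyr ⊢
  have hyr1 := abs_div_lt_one hr hyr
  have e1 : T x (b x) = H (x, r • shiftR) seqOne := by
    simp only [b]
    rw [← mul_apply_eq_comp, ← mul_assoc, Ring.mul_inverse_cancel _ hxU, one_mul]
  have e2 := congrArg (evalSeq (y / r)) e1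
  rw [H2 r hr hrR' x y _ (hxn.trans_le (min_le_right _ _)) hyr, evalSeq_seqOne hyr1, mul_one] at e2
  rw [← e2]
  simp only [T, add_apply, smul_apply, mul_apply_eq_comp, sub_apply, one_apply_eq_self, map_add,
    map_smul, map_sub]
  rw [F2 r hr hrR x y _ (hxn.trans_le (min_le_left _ _)) hyr, hfz, evalSeq_shiftR_pow hyr1,
    evalSeq_eq_sum hyr1 d (b x)]
  simp only [zero_mul, smul_zero, zero_add, add_sub_cancel_right]
  refine Finset.sum_congr rfl fun j _ => ?_
  rw [div_pow]; field_simp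

/-- Splitting off the largest power of the last variable. -/
theorem exists_factor {f : E × ℝ → ℝ} (hf : AnalyticAt ℝ f 0)
    (hf0 : ¬ ∀ᶠ z in 𝓝 (0 : E × ℝ), f z = 0) :
    ∃ (m : ℕ) (g : E × ℝ → ℝ), AnalyticAt ℝ g 0 ∧
      (∀ᶠ z in 𝓝 (0 : E × ℝ), f z = z.2 ^ m * g z) ∧ ¬ ∀ᶠ x in 𝓝 (0 : E), g (x, 0) = 0 := by
  obtain ⟨R, hR, C, F, a, F1, F2, -⟩ := exists_bddSeq_expansion hf
  obtain ⟨r, hr, hrR⟩ := exists_between hR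
  let c : E → BddSeq := fun x => F (x, r • shiftR) seqOne
  have hcan : ∀ x, ‖x‖ < R → AnalyticAt ℝ c x := by
    intro x hx
    have hY : ‖(x, r • shiftR)‖ < R := by
      simp only [Prod.norm_def, sup_lt_iff]
      exact ⟨hx, norm_smul_shiftR_lt hr hrR⟩
    exact ((ContinuousLinearMap.apply ℝ BddSeq seqOne).analyticAt _).comp
      (AnalyticAt.comp (f := fun x : E => (x, r • shiftR)) (F1 _ hY) (analyticAt_prodMk_left _ _))
  have hball : ∀ j, (∀ᶠ x in 𝓝 (0 : E), coord j (c x) = 0) → ∀ x, ‖x‖ < R → coord j (c x) = 0 := by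
    intro j hj x hx
    have := AnalyticOnNhd.eqOn_of_preconnected_of_eventuallyEq (𝕜 := ℝ)
      (f := fun x => coord j (c x)) (g := fun _ => 0) (U := Metric.ball (0 : E) R) (z₀ := 0)
      (fun x hx => ((coord j).analyticAt _).comp (hcan x (by simpa using hx)))
      (fun x _ => analyticAt_const) (convex_ball _ _).isPreconnected (by simpa using hR) hj
    exact this (by simpa using hx)
  have hfe : ∀ x y, ‖x‖ < R → |y| < r → f (x, y) = evalSeq (y / r) (c x) := by
    intro x y hx hy
    rw [F2 r hr hrR x y _ hx hy, evalSeq_seqOne (abs_div_lt_one hr hy), mul_one]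
  have hx : ∀ᶠ x in 𝓝 (0 : E), ‖x‖ < R := eventually_norm_lt hR
  have hy : ∀ᶠ y in 𝓝 (0 : ℝ), |y| < r := eventually_norm_lt (E := ℝ) hr
  have hxy := hx.prod_nhds hy
  rw [show ((0 : E), (0 : ℝ)) = 0 from rfl] at hxy
  have hex : ∃ j, ¬ ∀ᶠ x in 𝓝 (0 : E), coord j (c x) = 0 := by
    by_contra! hcon
    refine hf0 ?_
    filter_upwards [hxy] with ⟨x, y⟩ ⟨h1, h2⟩
    have : c x = 0 := BddSeq.ext_coord fun j => by rw [hball j (hcon j) x h1, map_zero]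
    rw [hfe x y h1 h2, this, map_zero]
  classical
  let m := Nat.find hex
  have hm : ¬ ∀ᶠ x in 𝓝 (0 : E), coord m (c x) = 0 := Nat.find_spec hex
  have hlt : ∀ j < m, ∀ᶠ x in 𝓝 (0 : E), coord j (c x) = 0 := fun j hj => by
    simpa using Nat.find_min hex hj
  refine ⟨m, fun z => (r ^ m)⁻¹ * evalSeq (z.2 / r) ((shiftL ^ m) (c z.1)), ?_, ?_, ?_⟩
  · have h1 : AnalyticAt ℝ (fun z : E × ℝ => evalSeq (z.2 / r)) 0 := by
      refine AnalyticAt.comp (f := fun z : E × ℝ => z.2 / r) (analyticAt_evalSeq (by simp)) ?_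
      simp only [div_eq_mul_inv]
      exact analyticAt_snd.mul analyticAt_const
    have h2 : AnalyticAt ℝ (fun z : E × ℝ => (shiftL ^ m) (c z.1)) 0 := by
      refine ((shiftL ^ m).analyticAt _).comp ?_
      exact AnalyticAt.comp (f := fun z : E × ℝ => z.1) (hcan _ (by simpa using hR)) analyticAt_fst
    exact analyticAt_const.mul (analyticAt_clm_apply h1 h2)
  · filter_upwards [hxy] with ⟨x, y⟩ ⟨h1, h2⟩
    simp only at h1 h2 ⊢
    rw [hfe x y h1 h2, evalSeq_eq_sum (abs_div_lt_one hr h2) m, Finset.sum_eq_zero, zero_add,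
      div_pow]
    · field_simp
    · intro j hj
      rw [hball j (hlt j (Finset.mem_range.1 hj)) x h1, zero_mul]
  · intro hcon
    refine hm ?_
    filter_upwards [hcon] with x hx
    rw [evalSeq_apply (by simp), zero_div, zero_mul, add_zero, coord_shiftL_pow, zero_add,
      mul_eq_zero] at hx
    exact hx.resolve_left (inv_ne_zero (pow_pos hr m).ne')

end Division

section Algebra

open Polynomial

/-- Integrality of elements is transitive along ring homomorphisms to a common ring. -/
theorem isIntegralElem_trans {A B L : Type*} [CommRing A] [CommRing B] [CommRing L]
    (ψ : A →+* L) (φ : B →+* L) (h : ∀ f, ψ.IsIntegralElem (φ f)) {v : L}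
    (hv : φ.IsIntegralElem v) : ψ.IsIntegralElem v := by
  let _ := ψ.toAlgebra
  let C := integralClosure A L
  let φ' : B →+* C := φ.codRestrict C h
  have h1 : IsIntegral C v := by
    obtain ⟨p, hp, hpv⟩ := hv
    refine ⟨p.map φ', hp.map _, ?_⟩
    rw [eval₂_map]
    exact hpv
  exact isIntegral_trans (R := A) (A := C) v h1

theorem exists_clear_denominators {A L : Type*} [CommRing A] [Field L] (φ : A →+* L)
    (p : (Subfield.closure (φ.range : Set L))[X]) :
    ∃ (P : A[X]) (δ : A), φ δ ≠ 0 ∧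
      P.map φ = C (φ δ) * p.map (Subfield.closure (φ.range : Set L)).subtype := by
  induction p using Polynomial.induction_on' with
  | add p q hp hq =>
    obtain ⟨P, δ, h, e⟩ := hp
    obtain ⟨Q, δ', h', e'⟩ := hq
    refine ⟨C δ' * P + C δ * Q, δ * δ', by rw [map_mul]; exact mul_ne_zero h h', ?_⟩
    simp only [Polynomial.map_add, Polynomial.map_mul, map_C, e, e', map_mul]
    ring
  | monomial n a =>
    obtain ⟨y, hy, z, hz, e⟩ := Subfield.mem_closure_iff.1 a.2
    rw [Subring.closure_eq] at hy hz
    obtain ⟨y, rfl⟩ := hy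
    obtain ⟨z, rfl⟩ := hz
    by_cases h : φ z = 0
    · refine ⟨0, 1, by simp, ?_⟩
      rw [h, div_zero] at e
      have ha : a = 0 := Subtype.ext e.symm
      rw [ha, map_zero, Polynomial.map_zero, Polynomial.map_zero, mul_zero]
    · refine ⟨monomial n y, z, h, ?_⟩
      simp only [map_monomial, C_mul_monomial, Subfield.subtype_apply, ← e]
      rw [mul_div_cancel₀ _ h]

/-- A separable annihilating polynomial, with Bézout and divisibility relations whose denominators
are cleared. -/
theorem exists_separable_factor {A L : Type*} [CommRing A] [Field L] [CharZero L] (φ : A →+* L)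
    {v : L} {q : A[X]} (hq : q.Monic) (hqv : eval₂ φ v q = 0) :
    ∃ (s U V ρ : A[X]) (δ : A), φ δ ≠ 0 ∧ eval₂ φ v s = 0 ∧
      (U * s + V * derivative s - C δ).map φ = 0 ∧ (s * ρ - C δ * q).map φ = 0 := by
  let K := Subfield.closure (φ.range : Set L)
  let φ' : A →+* K := φ.codRestrict K fun a => Subfield.subset_closure ⟨a, rfl⟩
  have hφ' : K.subtype.comp φ' = φ := rfl
  have hqv' : aeval v (q.map φ') = 0 := by
    rw [aeval_def, eval₂_map]; exact hqv
  have hvint : IsIntegral K v := ⟨q.map φ', hq.map _, hqv'⟩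
  obtain ⟨a, b, hab⟩ := (minpoly.irreducible hvint).separable
  obtain ⟨c, hc⟩ := minpoly.dvd K v hqv'
  obtain ⟨s, δ₁, h₁, e₁⟩ := exists_clear_denominators φ (minpoly K v)
  obtain ⟨U, δ₂, h₂, e₂⟩ := exists_clear_denominators φ a
  obtain ⟨V, δ₃, h₃, e₃⟩ := exists_clear_denominators φ b
  obtain ⟨ρ, δ₄, h₄, e₄⟩ := exists_clear_denominators φ c
  have hab' := congrArg (Polynomial.map K.subtype) hab
  simp only [Polynomial.map_add, Polynomial.map_mul, Polynomial.map_one] at hab'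
  have hc' := congrArg (Polynomial.map K.subtype) hc
  rw [Polynomial.map_map, hφ', Polynomial.map_mul] at hc'
  refine ⟨s, C (δ₃ * δ₄) * U, C (δ₂ * δ₄) * V, C (δ₂ * δ₃) * ρ, δ₁ * δ₂ * δ₃ * δ₄, ?_, ?_, ?_, ?_⟩
  · simp only [map_mul]
    exact mul_ne_zero (mul_ne_zero (mul_ne_zero h₁ h₂) h₃) h₄
  · rw [← eval_map, e₁, eval_mul, eval_map]
    have := minpoly.aeval K v
    rw [aeval_def] at this
    erw [this, mul_zero]
  · simp only [Polynomial.map_add, Polynomial.map_sub, Polynomial.map_mul, map_C, map_mul,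
      ← derivative_map, e₁, e₂, e₃, derivative_C_mul]
    simp only [derivative_map] at hab' ⊢
    linear_combination (C (φ δ₁) * C (φ δ₂) * C (φ δ₃) * C (φ δ₄)) * hab'
  · simp only [Polynomial.map_sub, Polynomial.map_mul, map_C, map_mul, e₁, e₄, hc']
    ring

end Algebra

section Germs

open Polynomial

/-- Functions analytic at the origin. -/
def analyticRing (B : Type*) [NormedAddCommGroup B] [NormedSpace ℝ B] : Subring (B → ℝ) where
  carrier := {f | AnalyticAt ℝ f 0}
  mul_mem' := fun ha hb => AnalyticAt.mul ha hb
  one_mem' := analyticAt_const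
  add_mem' := fun ha hb => AnalyticAt.add ha hb
  zero_mem' := analyticAt_const
  neg_mem' := fun ha => AnalyticAt.neg ha

variable {B : Type*} [NormedAddCommGroup B] [NormedSpace ℝ B] {I : Type*}

/-- Pullback of analytic functions along a family of points. -/
def pullHom (b : I → B) : analyticRing B →+* (I → ℝ) where
  toFun f k := f.1 (b k)
  map_one' := rfl
  map_mul' _ _ := rfl
  map_zero' := rfl
  map_add' _ _ := rfl

/-- Evaluation of analytic functions at a point. -/
def evHom (x : B) : analyticRing B →+* ℝ where
  toFun f := f.1 x
  map_one' := rfl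
  map_mul' _ _ := rfl
  map_zero' := rfl
  map_add' _ _ := rfl

@[simp] theorem evHom_apply (x : B) (f : analyticRing B) : evHom x f = f.1 x := rfl

/-- Germs of analytic functions along a family of points. -/
def germHom (l : Filter I) (b : I → B) : analyticRing B →+* Filter.Germ l ℝ :=
  (Filter.Germ.coeRingHom l).comp (pullHom b)

theorem germHom_eq_zero_iff {l : Filter I} {b : I → B} {f : analyticRing B} :
    germHom l b f = 0 ↔ ∀ᶠ k in l, f.1 (b k) = 0 := Filter.Germ.coe_eq

theorem eval₂_germHom (l : Filter I) (b : I → B) (g : I → ℝ) (p : (analyticRing B)[X]) :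
    eval₂ (germHom l b) (g : Filter.Germ l ℝ) p =
      ((fun k => eval₂ (evHom (b k)) (g k) p : I → ℝ) : Filter.Germ l ℝ) := by
  have h := hom_eval₂ p (pullHom b) (Filter.Germ.coeRingHom l) g
  have h2 : eval₂ (pullHom b) g p = fun k => eval₂ (evHom (b k)) (g k) p := by
    funext k
    exact hom_eval₂ p (pullHom b) (Pi.evalRingHom (fun _ => ℝ) k) g
  rw [h2] at h
  exact h.symm

theorem eval₂_germHom_eq_zero_iff {l : Filter I} {b : I → B} {g : I → ℝ}
    {p : (analyticRing B)[X]} :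
    eval₂ (germHom l b) (g : Filter.Germ l ℝ) p = 0 ↔
      ∀ᶠ k in l, eval₂ (evHom (b k)) (g k) p = 0 := by
  rw [eval₂_germHom]; exact Filter.Germ.coe_eq

/-- `g` is integral over the analytic functions along the family `b`. -/
def IntegralAlong (l : Filter I) (b : I → B) (g : I → ℝ) : Prop :=
  ∃ p : (analyticRing B)[X], p.Monic ∧ ∀ᶠ k in l, eval₂ (evHom (b k)) (g k) p = 0

theorem integralAlong_iff {l : Filter I} {b : I → B} {g : I → ℝ} :
    IntegralAlong l b g ↔ (germHom l b).IsIntegralElem (g : Filter.Germ l ℝ) := by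
  simp only [IntegralAlong, RingHom.IsIntegralElem, eval₂_germHom_eq_zero_iff]

theorem exists_coeff_analytic (p : (analyticRing B)[X]) :
    ∃ R > 0, ∀ x : B, ‖x‖ < R → ∀ j, AnalyticAt ℝ (p.coeff j).1 x := by
  have h : ∀ᶠ x in 𝓝 (0 : B), ∀ j ∈ p.support, AnalyticAt ℝ (p.coeff j).1 x :=
    (Filter.eventually_all_finset _).2 fun j _ => (p.coeff j).2.eventually_analyticAt
  obtain ⟨R, hR, h⟩ := Metric.eventually_nhds_iff_ball.1 h
  refine ⟨R, hR, fun x hx j => ?_⟩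
  by_cases hj : j ∈ p.support
  · exact h x (by simpa using hx) j hj
  · rw [notMem_support_iff.1 hj]; exact analyticAt_const

theorem analyticAt_eval₂ {p : (analyticRing B)[X]} {x : B}
    (h : ∀ j, AnalyticAt ℝ (p.coeff j).1 x) (y : ℝ) :
    AnalyticAt ℝ (fun z : B × ℝ => eval₂ (evHom z.1) z.2 p) (x, y) := by
  simp only [eval₂_eq_sum_range, evHom_apply]
  refine Finset.analyticAt_fun_sum _ fun j _ => ?_
  exact (AnalyticAt.comp (f := fun z : B × ℝ => z.1) (h j) analyticAt_fst).fun_mul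
    (analyticAt_snd.fun_pow j)

theorem analyticAt_eval₂_zero (p : (analyticRing B)[X]) (y : ℝ) :
    AnalyticAt ℝ (fun z : B × ℝ => eval₂ (evHom z.1) z.2 p) (0, y) :=
  analyticAt_eval₂ (fun j => (p.coeff j).2) y

theorem eventually_ne_zero_of_monic {p : (analyticRing B)[X]} (hp : p.Monic) :
    ∀ᶠ y in 𝓝[≠] (0 : ℝ), eval₂ (evHom (0 : B)) y p ≠ 0 := by
  have h0 : p.map (evHom (0 : B)) ≠ 0 := (hp.map _).ne_zero
  have := (p.map (evHom (0 : B))).roots.toFinset.finite_toSet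
  have h2 : ∀ᶠ y in 𝓝[≠] (0 : ℝ), y ∉ ((p.map (evHom (0 : B))).roots.toFinset : Set ℝ) :=
    (this.sdiff (t := {0})).isClosed.isOpen_compl.eventually_mem (x := (0:ℝ)) (by simp)
      |>.filter_mono nhdsWithin_le_nhds |>.and self_mem_nhdsWithin |>.mono
      fun y hy hy' => hy.1 ⟨hy', hy.2⟩
  filter_upwards [h2] with y hy h
  refine hy ?_
  simp [h0, eval_map, h]

/-- Analytic functions are integral over functions of the parameters, on the zero set of monic
polynomials in the individual variables. -/
theorem exists_monic_annihilator {n : ℕ} (q : Fin n → (analyticRing B)[X]) (hq : ∀ i, (q i).Monic)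
    {G : B × (Fin n → ℝ) → ℝ} (hG : AnalyticAt ℝ G 0) :
    IntegralAlong (𝓝 (0 : B × (Fin n → ℝ)) ⊓
      𝓟 {z | ∀ i, eval₂ (evHom z.1) (z.2 i) (q i) = 0}) Prod.fst G := by
  classical
  set Z : Set (B × (Fin n → ℝ)) := {z | ∀ i, eval₂ (evHom z.1) (z.2 i) (q i) = 0} with hZ
  set l := 𝓝 (0 : B × (Fin n → ℝ)) ⊓ 𝓟 Z with hl
  have hlZ : ∀ᶠ z in l, z ∈ Z := mem_inf_of_right (mem_principal_self Z)
  let cut : Finset (Fin n) → (Fin n → ℝ) →L[ℝ] (Fin n → ℝ) := fun s =>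
    ContinuousLinearMap.pi fun i => if i ∈ s then ContinuousLinearMap.proj i else 0
  have hcut : ∀ s v i, cut s v i = if i ∈ s then v i else 0 := by
    intro s v i
    simp only [cut, ContinuousLinearMap.pi_apply]
    split_ifs <;> simp
  suffices H : ∀ s : Finset (Fin n), ∀ G : B × (Fin n → ℝ) → ℝ, AnalyticAt ℝ G 0 →
      (∀ z, G z = G (z.1, cut s z.2)) → IntegralAlong l Prod.fst G from
    H Finset.univ G hG fun z => by
      have : cut Finset.univ z.2 = z.2 := by ext i; simp [hcut]
      rw [this]
  intro s
  induction s using Finset.induction_on with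
  | empty =>
    intro G hG hGs
    have h0 : ∀ v, cut ∅ v = 0 := fun v => by ext i; simp [hcut]
    have hg : AnalyticAt ℝ (fun b : B => G (b, 0)) 0 :=
      AnalyticAt.comp (f := fun b : B => (b, (0 : Fin n → ℝ))) hG (analyticAt_prodMk_left _ _)
    refine ⟨X - C ⟨_, hg⟩, monic_X_sub_C _, Eventually.of_forall fun z => ?_⟩
    rw [eval₂_sub, eval₂_X, eval₂_C, hGs z, h0]
    simp
  | insert i s his ih =>
    intro G hG hGs
    let Λ : (B × (Fin n → ℝ)) × ℝ →L[ℝ] B × (Fin n → ℝ) :=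
      ((ContinuousLinearMap.fst ℝ B (Fin n → ℝ)).comp (ContinuousLinearMap.fst ℝ _ ℝ)).prod
        (((cut s).comp ((ContinuousLinearMap.snd ℝ B (Fin n → ℝ)).comp
          (ContinuousLinearMap.fst ℝ _ ℝ))) +
          (ContinuousLinearMap.single ℝ (fun _ : Fin n => ℝ) i).comp
            (ContinuousLinearMap.snd ℝ (B × (Fin n → ℝ)) ℝ))
    have hΛ : ∀ b v y, Λ ((b, v), y) = (b, cut s v + Pi.single i y) := fun b v y => rfl
    have hh : AnalyticAt ℝ (fun z => G (Λ z)) 0 := by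
      refine AnalyticAt.comp (f := Λ) ?_ (Λ.analyticAt 0)
      rw [map_zero]; exact hG
    let Λ' : (B × (Fin n → ℝ)) × ℝ →L[ℝ] B × ℝ :=
      ((ContinuousLinearMap.fst ℝ B (Fin n → ℝ)).comp (ContinuousLinearMap.fst ℝ _ ℝ)).prod
        (ContinuousLinearMap.snd ℝ (B × (Fin n → ℝ)) ℝ)
    have hΛ' : ∀ b v y, Λ' ((b, v), y) = (b, y) := fun b v y => rfl
    have hf : AnalyticAt ℝ (fun z => eval₂ (evHom (Λ' z).1) (Λ' z).2 (q i)) 0 := by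
      refine AnalyticAt.comp (f := Λ') (g := fun z => eval₂ (evHom z.1) z.2 (q i)) ?_
        (Λ'.analyticAt 0)
      rw [map_zero]; exact analyticAt_eval₂_zero (q i) 0
    have hf0 : ¬ ∀ᶠ y in 𝓝 (0 : ℝ), eval₂ (evHom (Λ' ((0 : B × (Fin n → ℝ)), y)).1)
        (Λ' ((0 : B × (Fin n → ℝ)), y)).2 (q i) = 0 := by
      intro hcon
      obtain ⟨y, h1, h2⟩ :=
        ((eventually_ne_zero_of_monic (hq i)).and (hcon.filter_mono nhdsWithin_le_nhds)).exists
      exact h1 h2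
    obtain ⟨d, hd⟩ := exists_division hf hf0
    obtain ⟨r, hr, hrs⟩ := hd _ hh
    let κ : B × (Fin n → ℝ) →L[ℝ] B × (Fin n → ℝ) :=
      (ContinuousLinearMap.fst ℝ B (Fin n → ℝ)).prod
        ((cut s).comp (ContinuousLinearMap.snd ℝ B (Fin n → ℝ)))
    have hκ : ∀ z, κ z = (z.1, cut s z.2) := fun z => rfl
    have hcc : ∀ v, cut s (cut s v) = cut s v := by
      intro v; ext j; simp only [hcut]; split_ifs <;> rfl
    have hci : ∀ v, cut (insert i s) v = cut s v + Pi.single i (v i) := by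
      intro v; ext j
      by_cases hj : j = i
      · subst hj; simp [hcut, his]
      · simp [hcut, hj]
    have hrint : ∀ j, IntegralAlong l Prod.fst (fun z => r j (κ z)) := by
      intro j
      refine ih _ ?_ fun z => ?_
      · refine AnalyticAt.comp (f := κ) ?_ (κ.analyticAt 0)
        rw [map_zero]; exact hr j
      · simp only [hκ, hcc]
    have hvint : IntegralAlong l Prod.fst (fun z : B × (Fin n → ℝ) => z.2 i) :=
      ⟨q i, hq i, hlZ.mono fun z hz => hz i⟩
    simp only [integralAlong_iff] at hrint hvint ⊢
    have hGe : (G : Filter.Germ l ℝ) = ∑ j ∈ Finset.range d,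
        ((fun z => r j (κ z) : B × (Fin n → ℝ) → ℝ) : Filter.Germ l ℝ) *
          ((fun z => z.2 i : B × (Fin n → ℝ) → ℝ) : Filter.Germ l ℝ) ^ j := by
      have e1 : (∑ j ∈ Finset.range d,
        ((fun z => r j (κ z) : B × (Fin n → ℝ) → ℝ) : Filter.Germ l ℝ) *
          ((fun z => z.2 i : B × (Fin n → ℝ) → ℝ) : Filter.Germ l ℝ) ^ j) =
          ((∑ j ∈ Finset.range d, (fun z => r j (κ z)) *
            (fun z : B × (Fin n → ℝ) => z.2 i) ^ j : B × (Fin n → ℝ) → ℝ) : Filter.Germ l ℝ) := by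
        have := map_sum (Filter.Germ.coeRingHom (R := ℝ) l)
          (fun j => (fun z => r j (κ z)) * (fun z : B × (Fin n → ℝ) => z.2 i) ^ j) (Finset.range d)
        simp only [map_mul, map_pow] at this
        exact this.symm
      rw [e1]
      refine Filter.Germ.coe_eq.2 ?_
      have ht : Tendsto (fun z : B × (Fin n → ℝ) => (κ z, z.2 i)) l (𝓝 0) := by
        refine Tendsto.mono_left ?_ inf_le_left
        have : Continuous (fun z : B × (Fin n → ℝ) => (κ z, z.2 i)) := by fun_prop
        have h0 := this.tendsto 0
        simpa [← Prod.zero_eq_mk] using h0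
      filter_upwards [ht.eventually hrs, hlZ] with z hz hzZ
      have h1 := hz (hzZ i)
      have h2 : Λ (κ z, z.2 i) = (z.1, cut (insert i s) z.2) := by
        rw [hκ, hΛ, hcc, hci]
      rw [hGs z, ← h2, h1]
      simp
    let _ := (germHom l (Prod.fst : B × (Fin n → ℝ) → B)).toAlgebra
    have : IsIntegral (analyticRing B) (G : Filter.Germ l ℝ) := by
      rw [hGe]
      exact IsIntegral.sum _ fun j _ => IsIntegral.mul (hrint j) (IsIntegral.pow hvint j)
    exact this

end Germs

section Continuation

open scoped ContDiff

/-- On `J × [-η, η]`, the zeros of `σ` are simple in the second variable and avoid the boundary. -/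
structure NonDegenerate (σ : ℝ × ℝ → ℝ) (η : ℝ) (J : Set ℝ) : Prop where
  analyticAt : ∀ s ∈ J, ∀ y, AnalyticAt ℝ σ (s, y)
  abs_ne : ∀ s ∈ J, ∀ y, σ (s, y) = 0 → |y| ≠ η
  deriv_ne : ∀ s ∈ J, ∀ y, σ (s, y) = 0 → deriv (fun y => σ (s, y)) y ≠ 0

/-- `g` is an analytic branch of zeros of `σ` over `I` with values in `(-η, η)`. -/
def IsBranch (σ : ℝ × ℝ → ℝ) (η : ℝ) (I : Set ℝ) (g : ℝ → ℝ) : Prop :=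
  ∀ s ∈ I, AnalyticAt ℝ g s ∧ σ (s, g s) = 0 ∧ |g s| < η

theorem exists_implicit {σ : ℝ × ℝ → ℝ} {s y : ℝ} (h : AnalyticAt ℝ σ (s, y)) (h0 : σ (s, y) = 0)
    (hd : deriv (fun y => σ (s, y)) y ≠ 0) :
    ∃ g : ℝ → ℝ, AnalyticAt ℝ g s ∧ g s = y ∧ (∀ᶠ s' in 𝓝 s, σ (s', g s') = 0) ∧
      ∀ᶠ z in 𝓝 (s, y), σ z = 0 → g z.1 = z.2 := by
  have hc : ContDiffAt ℝ ω σ (s, y) := h.contDiffAt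
  have h1 : (fderiv ℝ σ (s, y) ∘L .inr ℝ ℝ ℝ) 1 = deriv (fun y => σ (s, y)) y := by
    have e1 : HasFDerivAt (fun y : ℝ => (s, y)) (ContinuousLinearMap.inr ℝ ℝ ℝ) y :=
      hasFDerivAt_prodMk_right s y
    have e2 : HasFDerivAt (fun y => σ (s, y)) (fderiv ℝ σ (s, y) ∘L .inr ℝ ℝ ℝ) y :=
      HasFDerivAt.comp (g := σ) (f := fun y : ℝ => (s, y)) y h.differentiableAt.hasFDerivAt e1
    exact e2.hasDerivAt.deriv.symm
  have hi : (fderiv ℝ σ (s, y) ∘L .inr ℝ ℝ ℝ).IsInvertible := by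
    rw [← h1] at hd
    refine ⟨ContinuousLinearEquiv.unitsEquivAut ℝ (Units.mk0 _ hd), ?_⟩
    ext
    simp
  refine ⟨hc.implicitFunction (by simp) hi, (hc.contDiffAt_implicitFunction (by simp) hi).analyticAt,
    hc.implicitFunction_apply_self (by simp) hi, ?_, ?_⟩
  · have := hc.eventually_apply_implicitFunction (by simp) hi
    rwa [h0] at this
  · have := hc.eventually_apply_eq_iff_implicitFunction (by simp) hi
    rw [h0] at this
    exact this.mono fun z hz => hz.1

variable {σ : ℝ × ℝ → ℝ} {η : ℝ} {J : Set ℝ}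

theorem IsBranch.mono {I I' : Set ℝ} {g : ℝ → ℝ} (h : IsBranch σ η I g) (hI : I' ⊆ I) :
    IsBranch σ η I' g := fun s hs => h s (hI hs)

theorem IsBranch.congr {I : Set ℝ} {g h : ℝ → ℝ} (hg : IsBranch σ η I g) (hI : IsOpen I)
    (e : Set.EqOn h g I) : IsBranch σ η I h := fun s hs => by
  have h1 : h =ᶠ[𝓝 s] g := e.eventuallyEq_of_mem (hI.mem_nhds hs)
  exact ⟨(hg s hs).1.congr h1.symm, by rw [e hs]; exact (hg s hs).2⟩

theorem NonDegenerate.eqOn (hσ : NonDegenerate σ η J) {I : Set ℝ} (hIo : IsOpen I) (hI : IsPreconnected I)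
    (hIJ : I ⊆ J) {g h : ℝ → ℝ} (hg : IsBranch σ η I g) (hh : IsBranch σ η I h) {a : ℝ}
    (ha : a ∈ I) (hab : g a = h a) : Set.EqOn g h I := by
  refine AnalyticOnNhd.eqOn_of_preconnected_of_eventuallyEq (𝕜 := ℝ) (fun s hs => (hg s hs).1)
    (fun s hs => (hh s hs).1) hI ha ?_
  obtain ⟨ψ, -, -, h3, h4⟩ := exists_implicit (hσ.analyticAt a (hIJ ha) (g a)) (hg a ha).2.1
    (hσ.deriv_ne a (hIJ ha) _ (hg a ha).2.1)
  have key : ∀ k : ℝ → ℝ, IsBranch σ η I k → k a = g a → ∀ᶠ s in 𝓝 a, ψ s = k s := by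
    intro k hk hka
    have ht : Tendsto (fun s => (s, k s)) (𝓝 a) (𝓝 (a, g a)) := by
      rw [← hka]
      exact tendsto_id.prodMk_nhds (hk a ha).1.continuousAt
    filter_upwards [ht.eventually h4, hIo.mem_nhds ha] with s hs hsI
    exact hs (hk s hsI).2.1
  filter_upwards [key g hg rfl, key h hh hab.symm] with s h5 h6
  rw [← h5, h6]

theorem NonDegenerate.exists_local (hσ : NonDegenerate σ η J) (hJ : IsOpen J) {c : ℝ} (hc : c ∈ J) :
    ∃ ρ > 0, Metric.ball c ρ ⊆ J ∧ ∀ s ∈ Metric.ball c ρ, ∀ y, |y| < η → σ (s, y) = 0 →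
      ∃ g, IsBranch σ η (Metric.ball c ρ) g ∧ g s = y := by
  obtain ⟨ρ₀, hρ₀, hρJ⟩ := Metric.isOpen_iff.1 hJ c hc
  suffices H : ∃ ρ > 0, ∀ s ∈ Metric.ball c ρ, ∀ y ∈ Set.Icc (-η) η, σ (s, y) = 0 →
      ∃ g, IsBranch σ η (Metric.ball c ρ) g ∧ g s = y by
    obtain ⟨ρ, hρ, H⟩ := H
    refine ⟨min ρ ρ₀, lt_min hρ hρ₀,
      (Metric.ball_subset_ball (min_le_right _ _)).trans hρJ, fun s hs y hy hsy => ?_⟩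
    obtain ⟨g, hg, hgs⟩ := H s (Metric.ball_subset_ball (min_le_left _ _) hs) y
      (abs_le.1 hy.le) hsy
    exact ⟨g, hg.mono (Metric.ball_subset_ball (min_le_left _ _)), hgs⟩
  refine IsCompact.induction_on (p := fun K => ∃ ρ > 0, ∀ s ∈ Metric.ball c ρ, ∀ y ∈ K,
    σ (s, y) = 0 → ∃ g, IsBranch σ η (Metric.ball c ρ) g ∧ g s = y) (isCompact_Icc (a := -η) (b := η))
    ?_ ?_ ?_ ?_
  · exact ⟨1, one_pos, fun s _ y hy => hy.elim⟩
  · rintro K K' hK ⟨ρ, hρ, H⟩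
    exact ⟨ρ, hρ, fun s hs y hy => H s hs y (hK hy)⟩
  · rintro K K' ⟨ρ, hρ, H⟩ ⟨ρ', hρ', H'⟩
    refine ⟨min ρ ρ', lt_min hρ hρ', fun s hs y hy hsy => ?_⟩
    rcases hy with hy | hy
    · obtain ⟨g, hg, hgs⟩ := H s (Metric.ball_subset_ball (min_le_left _ _) hs) y hy hsy
      exact ⟨g, hg.mono (Metric.ball_subset_ball (min_le_left _ _)), hgs⟩
    · obtain ⟨g, hg, hgs⟩ := H' s (Metric.ball_subset_ball (min_le_right _ _) hs) y hy hsy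
      exact ⟨g, hg.mono (Metric.ball_subset_ball (min_le_right _ _)), hgs⟩
  · intro y hy
    suffices H : ∃ ρ > 0, ∃ K ∈ 𝓝 y, ∀ s ∈ Metric.ball c ρ, ∀ y ∈ K, σ (s, y) = 0 →
        ∃ g, IsBranch σ η (Metric.ball c ρ) g ∧ g s = y by
      obtain ⟨ρ, hρ, K, hK, H⟩ := H
      exact ⟨K, mem_nhdsWithin_of_mem_nhds hK, ρ, hρ, H⟩
    by_cases h0 : σ (c, y) = 0
    · have hy' : |y| < η := lt_of_le_of_ne (abs_le.2 hy) (hσ.abs_ne c hc y h0)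
      obtain ⟨g, h1, h2, h3, h4⟩ := exists_implicit (hσ.analyticAt c hc y) h0 (hσ.deriv_ne c hc y h0)
      have h5 : ∀ᶠ s in 𝓝 c, |g s| < η := by
        have : Tendsto (fun s => |g s|) (𝓝 c) (𝓝 |g c|) := h1.continuousAt.abs
        rw [h2] at this
        exact this.eventually_lt_const hy'
      have h6 := h1.eventually_analyticAt.and (h3.and h5)
      obtain ⟨ρ, hρ, h6⟩ := Metric.eventually_nhds_iff_ball.1 h6
      rw [nhds_prod_eq] at h4
      obtain ⟨pa, hpa, pb, hpb, h4⟩ := eventually_prod_iff.1 h4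
      obtain ⟨ρ', hρ', h7⟩ := Metric.eventually_nhds_iff_ball.1 hpa
      refine ⟨min ρ ρ', lt_min hρ hρ', {y | pb y}, hpb, fun s hs y' hy' hsy => ⟨g, fun s' hs' =>
        h6 s' (Metric.ball_subset_ball (min_le_left _ _) hs'),
        h4 (h7 s (Metric.ball_subset_ball (min_le_right _ _) hs)) hy' hsy⟩⟩
    · have h4 : ∀ᶠ z in 𝓝 (c, y), σ z ≠ 0 :=
        (hσ.analyticAt c hc y).continuousAt.eventually_ne h0
      rw [nhds_prod_eq] at h4
      obtain ⟨pa, hpa, pb, hpb, h4⟩ := eventually_prod_iff.1 h4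
      obtain ⟨ρ', hρ', h7⟩ := Metric.eventually_nhds_iff_ball.1 hpa
      exact ⟨ρ', hρ', {y | pb y}, hpb, fun s hs y' hy' hsy => (h4 (h7 s hs) hy' hsy).elim⟩

/-- Global continuation of branches. -/
theorem NonDegenerate.exists_branch (hσ : NonDegenerate σ η J) (hJ : IsOpen J)
    (hJc : IsPreconnected J) {s₀ y₀ : ℝ} (hs₀ : s₀ ∈ J) (hy₀ : |y₀| < η) (h0 : σ (s₀, y₀) = 0) :
    ∃ g, IsBranch σ η J g ∧ g s₀ = y₀ := by
  classical
  let P : ℝ → Set ℝ → (ℝ → ℝ) → Prop := fun c I g =>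
    IsOpen I ∧ IsPreconnected I ∧ I ⊆ J ∧ s₀ ∈ I ∧ c ∈ I ∧ IsBranch σ η I g ∧ g s₀ = y₀
  let A : Set ℝ := {c | ∃ I g, P c I g}
  have hAo : IsOpen A := by
    refine isOpen_iff_mem_nhds.2 fun c ⟨I, g, h1, h2, h3, h4, h5, h6⟩ => ?_
    filter_upwards [h1.mem_nhds h5] with x hx using ⟨I, g, h1, h2, h3, h4, hx, h6⟩
  have hJA : J ⊆ A := by
    refine hJc.subset_of_closure_inter_subset hAo ⟨s₀, hs₀, ?_⟩ ?_
    · obtain ⟨ρ, hρ, hρJ, H⟩ := hσ.exists_local hJ hs₀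
      obtain ⟨g, hg, hgs⟩ := H s₀ (Metric.mem_ball_self hρ) y₀ hy₀ h0
      exact ⟨_, g, Metric.isOpen_ball, (convex_ball _ _).isPreconnected, hρJ,
        Metric.mem_ball_self hρ, Metric.mem_ball_self hρ, hg, hgs⟩
    · rintro c ⟨hcA, hcJ⟩
      obtain ⟨ρ, hρ, hρJ, H⟩ := hσ.exists_local hJ hcJ
      obtain ⟨a, haA, hac⟩ := Metric.mem_closure_iff.1 hcA ρ hρ
      rw [dist_comm] at hac
      obtain ⟨I, g, h1, h2, h3, h4, h5, h6, h7⟩ := haA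
      obtain ⟨h, hh, hha⟩ := H a hac (g a) (h6 a h5).2.2 (h6 a h5).2.1
      have hb : IsPreconnected (Metric.ball c ρ) := (convex_ball _ _).isPreconnected
      have hvint : IsPreconnected (I ∩ Metric.ball c ρ) :=
        (h2.ordConnected.inter hb.ordConnected).isPreconnected
      have he : Set.EqOn g h (I ∩ Metric.ball c ρ) :=
        hσ.eqOn (h1.inter Metric.isOpen_ball) hvint (Set.inter_subset_left.trans h3) (h6.mono Set.inter_subset_left)
          (hh.mono Set.inter_subset_right) ⟨h5, hac⟩ hha.symm
      have e1 : Set.EqOn (fun s => if s ∈ I then g s else h s) g I := fun s hs => if_pos hs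
      have e2 : Set.EqOn (fun s => if s ∈ I then g s else h s) h (Metric.ball c ρ) := by
        intro s hs
        by_cases hsI : s ∈ I
        · simpa [hsI] using he ⟨hsI, hs⟩
        · simp [hsI]
      refine ⟨I ∪ Metric.ball c ρ, fun s => if s ∈ I then g s else h s, h1.union Metric.isOpen_ball,
        h2.union a h5 hac hb, Set.union_subset h3 hρJ, Or.inl h4, Or.inr (Metric.mem_ball_self hρ),
        ?_, ?_⟩
      · rintro s (hs | hs)
        · exact (h6.congr h1 e1) s hs
        · exact (hh.congr Metric.isOpen_ball e2) s hs
      · rw [e1 h4, h7]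
  choose! I g hP using fun c (hc : c ∈ J) => hJA hc
  have key : ∀ c ∈ J, Set.EqOn (fun s => g s s) (g c) (I c) := by
    intro c hc s hs
    obtain ⟨h1, h2, h3, h4, h5, h6, h7⟩ := hP c hc
    obtain ⟨k1, k2, k3, k4, k5, k6, k7⟩ := hP s (h3 hs)
    exact hσ.eqOn (I := I s ∩ I c) (k1.inter h1) ((k2.ordConnected.inter h2.ordConnected).isPreconnected)
      (Set.inter_subset_left.trans k3) (k6.mono Set.inter_subset_left)
      (h6.mono Set.inter_subset_right) ⟨k4, h4⟩ (k7.trans h7.symm) ⟨k5, hs⟩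
  refine ⟨fun s => g s s, fun c hc => ?_, ?_⟩
  · obtain ⟨h1, h2, h3, h4, h5, h6, h7⟩ := hP c hc
    exact (h6.congr h1 (key c hc)) c h5
  · exact (hP s₀ hs₀).2.2.2.2.2.2

end Continuation

section Generic

open Polynomial

variable {B : Type*} [NormedAddCommGroup B] [NormedSpace ℝ B] {𝒰 : Ultrafilter ℕ} {b : ℕ → B}

theorem charZero_germ (𝒰 : Ultrafilter ℕ) : CharZero (Filter.Germ (𝒰 : Filter ℕ) ℝ) := inferInstance

/-- No nonzero analytic germ vanishes along the sequence. -/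
def GenericSeq (𝒰 : Ultrafilter ℕ) (b : ℕ → B) : Prop :=
  ∀ f : analyticRing B, (∀ᶠ k in (𝒰 : Filter ℕ), f.1 (b k) = 0) → ∀ᶠ x in 𝓝 (0 : B), f.1 x = 0

theorem eventually_map_eq_zero (hgen : GenericSeq 𝒰 b) {p : (analyticRing B)[X]}
    (hp : p.map (germHom 𝒰 b) = 0) : ∀ᶠ x in 𝓝 (0 : B), p.map (evHom x) = 0 := by
  have h : ∀ᶠ x in 𝓝 (0 : B), ∀ j ∈ p.support, (p.coeff j).1 x = 0 := by
    refine (Filter.eventually_all_finset _).2 fun j _ => hgen _ ?_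
    refine germHom_eq_zero_iff.1 ?_
    rw [← coeff_map, hp, coeff_zero]
  filter_upwards [h] with x hx
  ext j
  rw [coeff_map, coeff_zero]
  by_cases hj : j ∈ p.support
  · exact hx j hj
  · rw [notMem_support_iff.1 hj, map_zero]

/-- A polynomial `s` vanishing along the sequence, with simple zeros that are zeros of `q` wherever
`δ` does not vanish. -/
theorem exists_resolvent (hgen : GenericSeq 𝒰 b) {g : ℕ → ℝ} {q : (analyticRing B)[X]}
    (hq : q.Monic) (hqg : ∀ᶠ k in (𝒰 : Filter ℕ), eval₂ (evHom (b k)) (g k) q = 0) :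
    ∃ (s : (analyticRing B)[X]) (δ : analyticRing B), germHom 𝒰 b δ ≠ 0 ∧
      (∀ᶠ k in (𝒰 : Filter ℕ), eval₂ (evHom (b k)) (g k) s = 0) ∧
      ∀ᶠ x in 𝓝 (0 : B), δ.1 x ≠ 0 → ∀ y, eval₂ (evHom x) y s = 0 →
        eval₂ (evHom x) y q = 0 ∧ eval₂ (evHom x) y (derivative s) ≠ 0 := by
  have := charZero_germ 𝒰
  obtain ⟨s, U, V, ρ, δ, h1, h2, h3, h4⟩ := exists_separable_factor (germHom 𝒰 b) hq
    (v := ((g : ℕ → ℝ) : Filter.Germ (𝒰 : Filter ℕ) ℝ)) (eval₂_germHom_eq_zero_iff.2 hqg)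
  refine ⟨s, δ, h1, eval₂_germHom_eq_zero_iff.1 h2, ?_⟩
  filter_upwards [eventually_map_eq_zero hgen h3, eventually_map_eq_zero hgen h4] with x h5 h6 hδ y hy
  have e5 := congrArg (Polynomial.eval y) h5
  have e6 := congrArg (Polynomial.eval y) h6
  simp only [eval_map, eval₂_sub, eval₂_add, eval₂_mul, eval₂_C, hy, eval_zero, evHom_apply,
    mul_zero, zero_mul, zero_add, zero_sub, neg_eq_zero, mul_eq_zero, hδ, false_or] at e5 e6
  refine ⟨e6, fun h => hδ ?_⟩
  rw [h] at e5
  linarith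

/-- Functions vanishing along a generic sequence vanish near its points, on the zero set of monic
polynomials. -/
theorem exists_vanishing (hgen : GenericSeq 𝒰 b) {n : ℕ}
    {q : Fin n → (analyticRing B)[X]} (hq : ∀ i, (q i).Monic)
    {G : B × (Fin n → ℝ) → ℝ} (hG : AnalyticAt ℝ G 0) :
    ∃ c : B → ℝ, (∀ᶠ k in (𝒰 : Filter ℕ), c (b k) ≠ 0) ∧
      ∃ R > 0, (∀ z : B × (Fin n → ℝ), ‖z‖ < R → AnalyticAt ℝ G z) ∧
        ∀ z : B × (Fin n → ℝ), ‖z‖ < R → c z.1 ≠ 0 → G z = 0 →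
        ∀ᶠ z' in 𝓝 z, (∀ i, eval₂ (evHom z'.1) (z'.2 i) (q i) = 0) → G z' = 0 := by
  classical
  obtain ⟨P, hP, hPG⟩ := exists_monic_annihilator q hq hG
  have hex : ∃ m, ¬ ∀ᶠ x in 𝓝 (0 : B), (P.coeff m).1 x = 0 := by
    refine ⟨P.natDegree, fun h => ?_⟩
    have h1 : P.coeff P.natDegree = 1 := hP
    obtain ⟨x, hx⟩ := h.exists
    rw [h1] at hx
    exact one_ne_zero hx
  let m := Nat.find hex
  have hm : ¬ ∀ᶠ x in 𝓝 (0 : B), (P.coeff m).1 x = 0 := Nat.find_spec hex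
  have hlt : ∀ j ∈ Finset.range m, ∀ᶠ x in 𝓝 (0 : B), (P.coeff j).1 x = 0 := fun j hj => by
    simpa using Nat.find_min hex (Finset.mem_range.1 hj)
  have hlt' := (Filter.eventually_all_finset _).2 hlt
  obtain ⟨R₁, hR₁, h₁⟩ := exists_coeff_analytic P
  obtain ⟨R₂, hR₂, h₂⟩ := Metric.eventually_nhds_iff_ball.1 hlt'
  obtain ⟨R₃, hR₃, h₃⟩ := Metric.eventually_nhds_iff_ball.1 hG.eventually_analyticAt
  obtain ⟨R₄, hR₄, h₄⟩ := Metric.eventually_nhds_iff_ball.1 (eventually_inf_principal.1 hPG)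
  refine ⟨(P.coeff m).1, ?_, min (min R₁ R₂) (min R₃ R₄), by positivity, fun z hz => ?_, ?_⟩
  · exact Ultrafilter.eventually_not.2 fun h => hm (hgen _ h)
  · exact h₃ z (by simp only [lt_min_iff] at hz; simpa using hz.2.1)
  intro z hz hcz hGz
  simp only [lt_min_iff] at hz
  obtain ⟨⟨hz1, hz2⟩, hz3, hz4⟩ := hz
  let Q : B × (Fin n → ℝ) → ℝ := fun z =>
    ∑ j ∈ Finset.range (P.natDegree + 1), (P.coeff (m + j)).1 z.1 * G z ^ j
  have hGc : ContinuousAt G z := (h₃ z (by simpa using hz3)).continuousAt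
  have hz1' : ‖z.1‖ < R₁ := (norm_fst_le z).trans_lt hz1
  have hQ : ContinuousAt Q z := by
    refine tendsto_finsetSum _ fun j _ => ?_
    refine Tendsto.mul ?_ (hGc.pow j)
    exact ContinuousAt.comp (f := fun z : B × (Fin n → ℝ) => z.1)
      ((h₁ z.1 hz1' (m + j)).continuousAt) continuousAt_fst
  have hQz : Q z ≠ 0 := by
    have : Q z = (P.coeff m).1 z.1 := by
      simp only [Q, hGz]
      rw [Finset.sum_range_succ', Finset.sum_eq_zero]
      · simp
      · intro j _; simp
    rw [this]; exact hcz
  have hball : ∀ {R : ℝ}, ‖z‖ < R → ∀ᶠ z' in 𝓝 z, z' ∈ Metric.ball (0 : B × (Fin n → ℝ)) R :=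
    fun h => Metric.isOpen_ball.mem_nhds (by simpa using h)
  filter_upwards [hQ.eventually_ne hQz, hball hz2, hball hz4] with z' e1 e2 e4 hzZ
  have e5 := h₄ z' e4 hzZ
  have e6 : ∀ j ∈ Finset.range m, (P.coeff j).1 z'.1 = 0 :=
    h₂ z'.1 (by simpa using (norm_fst_le z').trans_lt (by simpa using e2))
  have e7 : eval₂ (evHom z'.1) (G z') P = G z' ^ m * Q z' := by
    rw [eval₂_eq_sum_range' (evHom z'.1) (n := m + (P.natDegree + 1)) (by omega), Finset.sum_range_add,
      Finset.sum_eq_zero, zero_add, Finset.mul_sum]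
    · refine Finset.sum_congr rfl fun j _ => ?_
      simp only [evHom_apply, pow_add]; ring
    · intro j hj
      rw [evHom_apply, e6 j hj, zero_mul]
  rw [e7, mul_eq_zero] at e5
  exact eq_zero_of_pow_eq_zero (e5.resolve_right e1)

/-- Arbitrarily small levels avoided by the zeros of finitely many monic polynomials. -/
theorem exists_level {n : ℕ} {q : Fin n → (analyticRing B)[X]} (hq : ∀ i, (q i).Monic) {η : ℝ}
    (hη : 0 < η) : ∃ η', 0 < η' ∧ η' < η ∧ ∀ᶠ x in 𝓝 (0 : B), ∀ i y,
      eval₂ (evHom x) y (q i) = 0 → |y| ≠ η' := by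
  have h1 : ∀ᶠ y in 𝓝[≠] (0 : ℝ), ∀ i, eval₂ (evHom (0 : B)) y (q i) ≠ 0 :=
    eventually_all.2 fun i => eventually_ne_zero_of_monic (hq i)
  have h2 : ∀ᶠ y in 𝓝[>] (0 : ℝ), ∀ i, eval₂ (evHom (0 : B)) y (q i) ≠ 0 :=
    h1.filter_mono (nhdsWithin_mono _ fun y hy => ne_of_gt hy)
  have ht : Tendsto (fun y : ℝ => -y) (𝓝[>] 0) (𝓝[≠] 0) := by
    refine tendsto_nhdsWithin_iff.2 ⟨?_, ?_⟩
    · have := (continuous_neg (G := ℝ)).tendsto 0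
      rw [neg_zero] at this
      exact this.mono_left nhdsWithin_le_nhds
    · filter_upwards [self_mem_nhdsWithin] with y hy
      simpa using (ne_of_gt hy)
  obtain ⟨η', ⟨h3, h4⟩, h5, h6⟩ :=
    ((h2.and (ht.eventually h1)).and (Ioo_mem_nhdsGT hη)).exists
  refine ⟨η', h5, h6, eventually_all.2 fun i => ?_⟩
  have hc : ∀ y, ContinuousAt (fun x : B => eval₂ (evHom x) y (q i)) 0 := fun y =>
    ContinuousAt.comp (f := fun x : B => (x, y)) (analyticAt_eval₂_zero (q i) y).continuousAt
      (analyticAt_prodMk_left _ _).continuousAt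
  filter_upwards [(hc η').eventually_ne (h3 i), (hc (-η')).eventually_ne (h4 i)] with x e1 e2 y hy habs
  rcases eq_or_eq_neg_of_abs_eq habs with rfl | rfl
  · exact e1 hy
  · exact e2 hy

end Generic

section Paths

open Polynomial

variable {B : Type*} [NormedAddCommGroup B] [NormedSpace ℝ B] {𝒰 : Ultrafilter ℕ} {b : ℕ → B}
  {n : ℕ} {v : ℕ → Fin n → ℝ} {q : Fin n → (analyticRing B)[X]}

theorem exists_nonDegenerate (hgen : GenericSeq 𝒰 b) (hq : ∀ i, (q i).Monic)
    (hqv : ∀ i, ∀ᶠ k in (𝒰 : Filter ℕ), eval₂ (evHom (b k)) (v k i) (q i) = 0) :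
    ∃ (s : Fin n → (analyticRing B)[X]) (δ : analyticRing B), ∃ η > 0, ∃ R > 0,
      germHom 𝒰 b δ ≠ 0 ∧ (∀ i, ∀ᶠ k in (𝒰 : Filter ℕ), eval₂ (evHom (b k)) (v k i) (s i) = 0) ∧
      (∀ x, ‖x‖ < R → AnalyticAt ℝ δ.1 x) ∧
      ∀ (J : Set ℝ) (β : ℝ → B), (∀ r ∈ J, AnalyticAt ℝ β r ∧ ‖β r‖ < R ∧ δ.1 (β r) ≠ 0) →
        ∀ i, NonDegenerate (fun z => eval₂ (evHom (β z.1)) z.2 (s i)) η J ∧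
          ∀ r ∈ J, ∀ y, eval₂ (evHom (β r)) y (s i) = 0 → eval₂ (evHom (β r)) y (q i) = 0 := by
  choose s δ h1 h2 h3 using fun i => exists_resolvent hgen (hq i) (hqv i)
  obtain ⟨η, hη, -, h4⟩ := exists_level hq one_pos
  choose R₁ hR₁ h5 using fun i => exists_coeff_analytic (s i)
  have h6 : ∀ᶠ x in 𝓝 (0 : B), ∀ i, ∀ j, AnalyticAt ℝ ((s i).coeff j).1 x := by
    refine eventually_all.2 fun i => ?_
    filter_upwards [eventually_norm_lt (hR₁ i)] with x hx using h5 i x hx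
  have hδ : ∀ x, (∏ i, δ i).1 x = ∏ i, (δ i).1 x := fun x => map_prod (evHom x) _ _
  obtain ⟨R, hR, h7⟩ := Metric.eventually_nhds_iff_ball.1
    (((eventually_all.2 h3).and h4).and (h6.and (∏ i, δ i).2.eventually_analyticAt))
  refine ⟨s, ∏ i, δ i, η, hη, R, hR, ?_, h2, fun x hx => (h7 x (by simpa using hx)).2.2, ?_⟩
  · rw [map_prod]
    exact Finset.prod_ne_zero_iff.2 fun i _ => h1 i
  intro J β hβ i
  have key : ∀ r ∈ J, ∀ y, eval₂ (evHom (β r)) y (s i) = 0 →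
      eval₂ (evHom (β r)) y (q i) = 0 ∧ eval₂ (evHom (β r)) y (derivative (s i)) ≠ 0 := by
    intro r hr
    obtain ⟨-, hb2, hb3⟩ := hβ r hr
    rw [hδ] at hb3
    exact (h7 (β r) (by simpa using hb2)).1.1 i (Finset.prod_ne_zero_iff.1 hb3 i (Finset.mem_univ i))
  refine ⟨⟨fun r hr y => ?_, fun r hr y h0 => ?_, fun r hr y h0 => ?_⟩, fun r hr y h0 => (key r hr y h0).1⟩
  · obtain ⟨hb1, hb2, -⟩ := hβ r hr
    have e1 : AnalyticAt ℝ (fun z : B × ℝ => eval₂ (evHom z.1) z.2 (s i)) (β r, y) :=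
      analyticAt_eval₂ ((h7 (β r) (by simpa using hb2)).2.1 i) y
    have e2 : AnalyticAt ℝ (fun z : ℝ × ℝ => β z.1) (r, y) :=
      AnalyticAt.comp (f := fun z : ℝ × ℝ => z.1) (g := β) hb1 analyticAt_fst
    exact AnalyticAt.comp (f := fun z : ℝ × ℝ => (β z.1, z.2)) e1 (e2.prod analyticAt_snd)
  · exact (h7 (β r) (by simpa using (hβ r hr).2.1)).1.2 i y (key r hr y h0).1
  · have e : (fun y => eval₂ (evHom (β r)) y (s i)) =
        fun y => ((s i).map (evHom (β r))).eval y := by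
      funext y; rw [eval_map]
    have := (key r hr y h0).2
    simp only [] at h0 ⊢
    rw [e, Polynomial.deriv, derivative_map, eval_map]
    exact this

theorem abs_lt_of_isPreconnected {J : Set ℝ} (hJ : IsPreconnected J) {y : ℝ → ℝ}
    (hy : ContinuousOn y J) {η : ℝ} (hη : ∀ r ∈ J, |y r| ≠ η) {a : ℝ} (ha : a ∈ J) (hya : |y a| < η) :
    ∀ r ∈ J, |y r| < η := by
  intro r hr
  by_contra! h
  obtain ⟨c, hc, hc'⟩ := hJ.intermediate_value ha hr hy.abs ⟨hya.le, h⟩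
  exact hη c hc hc'

theorem exists_trap (hq : ∀ i, (q i).Monic) (hv : Tendsto v 𝒰 (𝓝 0)) {η : ℝ} (hη : 0 < η) :
    ∃ R > 0, ∀ᶠ k in (𝒰 : Filter ℕ), ∀ (J : Set ℝ) (β : ℝ → B) (y : ℝ → Fin n → ℝ) (a : ℝ),
      IsPreconnected J → a ∈ J → ContinuousOn y J → (∀ r ∈ J, ‖β r‖ < R) → y a = v k →
      (∀ r ∈ J, ∀ i, eval₂ (evHom (β r)) (y r i) (q i) = 0) → ∀ r ∈ J, ‖y r‖ < η := by
  obtain ⟨η', h1, h2, h3⟩ := exists_level hq hη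
  obtain ⟨R, hR, h4⟩ := Metric.eventually_nhds_iff_ball.1 h3
  refine ⟨R, hR, ?_⟩
  filter_upwards [hv.eventually (eventually_norm_lt h1)] with k hk J β y a hJ ha hy hβ hya hqy r hr
  refine (pi_norm_lt_iff hη).2 fun i => ?_
  rw [Real.norm_eq_abs]
  refine (abs_lt_of_isPreconnected hJ (y := fun r => y r i) ?_ (η := η') ?_ ha ?_ r hr).trans h2
  · exact (continuous_apply i).comp_continuousOn hy
  · exact fun r hr => h4 (β r) (by simpa using hβ r hr) i _ (hqy r hr i)
  · rw [hya]; exact (norm_le_pi_norm (v k) i).trans_lt hk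

theorem exists_vanishing_along (hgen : GenericSeq 𝒰 b) (hq : ∀ i, (q i).Monic)
    {G : B × (Fin n → ℝ) → ℝ} (hG : AnalyticAt ℝ G 0)
    (hGv : ∀ᶠ k in (𝒰 : Filter ℕ), G (b k, v k) = 0) :
    ∃ R > 0, (∀ z : B × (Fin n → ℝ), ‖z‖ < R → AnalyticAt ℝ G z) ∧
      ∀ᶠ k in (𝒰 : Filter ℕ), ∀ (J : Set ℝ) (β : ℝ → B) (y : ℝ → Fin n → ℝ) (a : ℝ),
      IsOpen J → IsPreconnected J → a ∈ J → (∀ r ∈ J, AnalyticAt ℝ β r) →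
      (∀ r ∈ J, AnalyticAt ℝ y r) → (∀ r ∈ J, ‖(β r, y r)‖ < R) → β a = b k → y a = v k →
      (∀ r ∈ J, ∀ i, eval₂ (evHom (β r)) (y r i) (q i) = 0) → ∀ r ∈ J, G (β r, y r) = 0 := by
  obtain ⟨c, hc, R, hR, hR1, hR2⟩ := exists_vanishing hgen hq hG
  refine ⟨R, hR, hR1, ?_⟩
  filter_upwards [hc, hGv] with k hck hGk J β y a hJ hJc ha hβ hy hRJ hβa hya hqy
  have han : AnalyticOnNhd ℝ (fun r => G (β r, y r)) J := fun r hr =>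
    AnalyticAt.comp (f := fun r => (β r, y r)) (hR1 _ (hRJ r hr)) ((hβ r hr).prod (hy r hr))
  refine han.eqOn_zero_of_preconnected_of_eventuallyEq_zero hJc ha ?_
  have h1 := hR2 (β a, y a) (hRJ a ha) (by rwa [hβa]) (by rwa [hβa, hya])
  have h2 : Tendsto (fun r => (β r, y r)) (𝓝 a) (𝓝 (β a, y a)) :=
    ((hβ a ha).prod (hy a ha)).continuousAt
  filter_upwards [h2.eventually h1, hJ.mem_nhds ha] with r e1 e2 using e1 (hqy r e2)

end Paths

section Degeneration

open Polynomial

variable {E : Type*} [NormedAddCommGroup E] [NormedSpace ℝ E] {n : ℕ}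

/-- A path towards the hyperplane `e = 0`. -/
def shrink (b : ℝ × E) (r : ℝ) : ℝ × E := (b.1, (1 - r ^ 2) • b.2)

theorem shrink_zero (b : ℝ × E) : shrink b 0 = b := by simp [shrink]

theorem analyticAt_shrink (b : ℝ × E) (r : ℝ) : AnalyticAt ℝ (shrink b) r :=
  analyticAt_const.prod
    ((analyticAt_const.fun_sub (analyticAt_id.fun_pow 2)).fun_smul analyticAt_const)

theorem norm_shrink_le (b : ℝ × E) {r : ℝ} (hr : |r| ≤ 1) : ‖shrink b r‖ ≤ ‖b‖ := by
  have h1 : r ^ 2 ≤ 1 := (sq_le_one_iff_abs_le_one r).2 hr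
  have h2 : |1 - r ^ 2| ≤ 1 := abs_le.2 ⟨by linarith, by nlinarith [sq_nonneg r]⟩
  refine norm_prod_le_iff.2 ⟨norm_fst_le b, ?_⟩
  calc ‖(1 - r ^ 2) • b.2‖ = |1 - r ^ 2| * ‖b.2‖ := norm_smul _ _
    _ ≤ 1 * ‖b.2‖ := by gcongr
    _ ≤ ‖b‖ := by rw [one_mul]; exact norm_snd_le b

/-- The data of a branch over the path `shrink b`, followed until `δ` vanishes or `e = 0`. -/
structure Shrinking (q : Fin n → (analyticRing (ℝ × E))[X]) (δ : analyticRing (ℝ × E)) (b : ℝ × E)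
    (v : Fin n → ℝ) (S : ℝ) (v' : Fin n → ℝ) (y : ℝ → Fin n → ℝ) (V : Ultrafilter ℝ) : Prop where
  pos : 0 < S
  le_one : S ≤ 1
  le_nhds : (V : Filter ℝ) ≤ 𝓝[<] S
  tendsto : Tendsto y V (𝓝 v')
  analyticAt : ∀ r ∈ Set.Ioo (-S) S, AnalyticAt ℝ y r
  apply_zero : y 0 = v
  eval_eq_zero : ∀ r ∈ Set.Ioo (-S) S, ∀ i, eval₂ (evHom (shrink b r)) (y r i) (q i) = 0
  degenerate : δ.1 (shrink b S) = 0 ∨ S = 1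

theorem exists_shrinking {q s : Fin n → (analyticRing (ℝ × E))[X]} {δ : analyticRing (ℝ × E)}
    {η R : ℝ} {b : ℝ × E} {v : Fin n → ℝ} (hδ : ∀ x, ‖x‖ < R → AnalyticAt ℝ δ.1 x)
    (hnd : ∀ (J : Set ℝ) (β : ℝ → ℝ × E),
      (∀ r ∈ J, AnalyticAt ℝ β r ∧ ‖β r‖ < R ∧ δ.1 (β r) ≠ 0) →
        ∀ i, NonDegenerate (fun z => eval₂ (evHom (β z.1)) z.2 (s i)) η J ∧
          ∀ r ∈ J, ∀ y, eval₂ (evHom (β r)) y (s i) = 0 → eval₂ (evHom (β r)) y (q i) = 0)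
    (hbR : ‖b‖ < R) (hδb : δ.1 b ≠ 0) (hvη : ∀ i, |v i| < η)
    (hvs : ∀ i, eval₂ (evHom b) (v i) (s i) = 0)
    (htrap : ∀ (J : Set ℝ) (y : ℝ → Fin n → ℝ), IsPreconnected J → 0 ∈ J → ContinuousOn y J →
      (∀ r ∈ J, |r| ≤ 1) → y 0 = v →
      (∀ r ∈ J, ∀ i, eval₂ (evHom (shrink b r)) (y r i) (q i) = 0) → ∀ r ∈ J, ‖y r‖ < 1) :
    ∃ S v' y V, Shrinking q δ b v S v' y V := by
  have hc : ContinuousOn (fun r => δ.1 (shrink b r)) (Set.Icc 0 1) := fun r hr => by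
    refine ContinuousAt.continuousWithinAt ?_
    refine ContinuousAt.comp (f := shrink b) (hδ _ ?_).continuousAt (analyticAt_shrink b r).continuousAt
    exact (norm_shrink_le b (abs_le.2 ⟨by linarith [hr.1], hr.2⟩)).trans_lt hbR
  have hD : IsClosed (Set.Icc (0 : ℝ) 1 ∩ (fun r => δ.1 (shrink b r) * (r - 1)) ⁻¹' {0}) :=
    (hc.mul (by fun_prop)).preimage_isClosed_of_isClosed isClosed_Icc isClosed_singleton
  obtain ⟨S, ⟨⟨hS0, hS1⟩, hS2⟩, hS3⟩ := (isCompact_Icc.of_isClosed_subset hD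
    Set.inter_subset_left).exists_isLeast ⟨1, by simp⟩
  have hdeg : δ.1 (shrink b S) = 0 ∨ S = 1 := by
    simpa [sub_eq_zero] using hS2
  have hSpos : 0 < S := by
    refine lt_of_le_of_ne hS0 fun h => ?_
    rw [← h, shrink_zero] at hdeg
    rcases hdeg with h | h
    · exact hδb h
    · exact zero_ne_one h
  have habs : ∀ r ∈ Set.Ioo (-S) S, |r| ≤ 1 := fun r hr => (abs_lt.2 hr).le.trans hS1
  have hJ : ∀ r ∈ Set.Ioo (-S) S, AnalyticAt ℝ (shrink b) r ∧ ‖shrink b r‖ < R ∧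
      δ.1 (shrink b r) ≠ 0 := by
    refine fun r hr => ⟨analyticAt_shrink b r, (norm_shrink_le b (habs r hr)).trans_lt hbR,
      fun h0 => ?_⟩
    have h1 : shrink b |r| = shrink b r := by simp [shrink]
    exact (abs_lt.2 hr).not_ge (hS3 ⟨⟨abs_nonneg r, habs r hr⟩, by simp [h1, h0]⟩)
  have h0J : (0 : ℝ) ∈ Set.Ioo (-S) S := ⟨by linarith, hSpos⟩
  have hbr : ∀ i, ∃ g, IsBranch (fun z => eval₂ (evHom (shrink b z.1)) z.2 (s i)) η
      (Set.Ioo (-S) S) g ∧ g 0 = v i := fun i =>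
    (hnd _ _ hJ i).1.exists_branch isOpen_Ioo isPreconnected_Ioo h0J (hvη i)
      (by simpa only [shrink_zero] using hvs i)
  choose g hg hg0 using hbr
  have hy : ∀ r ∈ Set.Ioo (-S) S, AnalyticAt ℝ (fun r i => g i r) r := fun r hr =>
    AnalyticAt.pi fun i => (hg i r hr).1
  have hq : ∀ r ∈ Set.Ioo (-S) S, ∀ i, eval₂ (evHom (shrink b r)) (g i r) (q i) = 0 := fun r hr i =>
    (hnd _ _ hJ i).2 r hr _ (hg i r hr).2.1
  have hbd := htrap _ (fun r i => g i r) isPreconnected_Ioo h0J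
    (fun r hr => (hy r hr).continuousAt.continuousWithinAt) habs (funext hg0) hq
  have hmem : Set.Ioo (-S) S ∈ 𝓝[<] S := Ioo_mem_nhdsLT (by linarith)
  obtain ⟨v', -, hv'⟩ := (isCompact_closedBall (0 : Fin n → ℝ) 1).exists_mapClusterPt
    (f := 𝓝[<] S) (u := fun r i => g i r) (by
      rw [le_principal_iff, mem_map]
      filter_upwards [hmem] with r hr
      simpa using (hbd r hr).le)
  obtain ⟨V, hV, hyV⟩ := mapClusterPt_iff_ultrafilter.1 hv'
  exact ⟨S, v', _, V, hSpos, hS1, hV, hyV, hy, funext hg0, hq, hdeg⟩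

variable {𝒰 : Ultrafilter ℕ} {t : ℕ → ℝ} {e : ℕ → E} {v : ℕ → Fin n → ℝ}

theorem exists_degeneration {q : Fin n → (analyticRing (ℝ × E))[X]}
    (hgen : GenericSeq 𝒰 fun k => (t k, e k)) (hq : ∀ i, (q i).Monic)
    (hqv : ∀ i, ∀ᶠ k in (𝒰 : Filter ℕ), eval₂ (evHom (t k, e k)) (v k i) (q i) = 0)
    (ht : Tendsto t 𝒰 (𝓝 0)) (he : Tendsto e 𝒰 (𝓝 0)) (hv : Tendsto v 𝒰 (𝓝 0)) :
    ∃ (δ : analyticRing (ℝ × E)) (c : ℕ → ℝ) (v' : ℕ → Fin n → ℝ),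
      (¬ ∀ᶠ k in (𝒰 : Filter ℕ), δ.1 (t k, e k) = 0) ∧ (∀ᶠ k in (𝒰 : Filter ℕ), |c k| ≤ 1) ∧
      (∀ᶠ k in (𝒰 : Filter ℕ), δ.1 (t k, c k • e k) = 0 ∨ c k = 0) ∧ Tendsto v' 𝒰 (𝓝 0) ∧
      ∀ G : (ℝ × E) × (Fin n → ℝ) → ℝ, AnalyticAt ℝ G 0 →
        (∀ᶠ k in (𝒰 : Filter ℕ), G ((t k, e k), v k) = 0) →
        ∀ᶠ k in (𝒰 : Filter ℕ), G ((t k, c k • e k), v' k) = 0 := by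
  have hb : Tendsto (fun k => (t k, e k)) 𝒰 (𝓝 0) := ht.prodMk_nhds he
  obtain ⟨s, δ, η, hη, R, hR, hδ, hsv, hδR, hnd⟩ := exists_nonDegenerate hgen hq hqv
  have hδ' : ¬ ∀ᶠ k in (𝒰 : Filter ℕ), δ.1 (t k, e k) = 0 := fun h => hδ (germHom_eq_zero_iff.2 h)
  obtain ⟨R₁, hR₁, htrap⟩ := exists_trap (B := ℝ × E) hq hv one_pos
  have hstep : ∀ᶠ k in (𝒰 : Filter ℕ), ∃ x : ℝ × (Fin n → ℝ) × (ℝ → Fin n → ℝ) × Ultrafilter ℝ,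
      Shrinking q δ (t k, e k) (v k) x.1 x.2.1 x.2.2.1 x.2.2.2 := by
    filter_upwards [htrap, Ultrafilter.eventually_not.2 hδ', eventually_all.2 hsv,
      hb.eventually (eventually_norm_lt hR), hb.eventually (eventually_norm_lt hR₁),
      hv.eventually (eventually_norm_lt hη)] with k h1 h2 h3 h4 h5 h6
    obtain ⟨S, v', y, V, h⟩ := exists_shrinking hδR hnd h4 h2
      (fun i => (norm_le_pi_norm (v k) i).trans_lt h6) h3
      (fun J y hJ h0 hy hJ1 hy0 hqy => h1 J (shrink (t k, e k)) y 0 hJ h0 hy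
        (fun r hr => (norm_shrink_le _ (hJ1 r hr)).trans_lt h5) hy0 hqy)
    exact ⟨⟨S, v', y, V⟩, h⟩
  obtain ⟨x, hx⟩ := hstep.choice
  have h0J : ∀ {S : ℝ}, 0 < S → (0 : ℝ) ∈ Set.Ioo (-S) S := fun h => ⟨by linarith, h⟩
  have hmem : ∀ {S : ℝ} {V : Ultrafilter ℝ}, 0 < S → (V : Filter ℝ) ≤ 𝓝[<] S →
      ∀ᶠ r in (V : Filter ℝ), r ∈ Set.Ioo (-S) S := fun h hV => hV (Ioo_mem_nhdsLT (by linarith))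
  have hsmall : ∀ {η : ℝ}, 0 < η → ∀ᶠ k in (𝒰 : Filter ℕ),
      ∀ r ∈ Set.Ioo (-(x k).1) (x k).1, ‖(x k).2.2.1 r‖ < η := by
    intro η hη
    obtain ⟨R, hR, h⟩ := exists_trap (B := ℝ × E) hq hv hη
    filter_upwards [h, hx, hb.eventually (eventually_norm_lt hR)] with k h1 h2 h3
    exact h1 _ (shrink (t k, e k)) _ 0 isPreconnected_Ioo (h0J h2.pos)
      (fun r hr => (h2.analyticAt r hr).continuousAt.continuousWithinAt)
      (fun r hr => (norm_shrink_le _ ((abs_lt.2 hr).le.trans h2.le_one)).trans_lt h3)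
      h2.apply_zero h2.eval_eq_zero
  have hv' : Tendsto (fun k => (x k).2.1) 𝒰 (𝓝 0) := by
    refine Metric.tendsto_nhds.2 fun η hη => ?_
    filter_upwards [hsmall (half_pos hη), hx] with k h1 h2
    rw [dist_zero_right]
    refine lt_of_le_of_lt (le_of_tendsto h2.tendsto.norm ?_) (half_lt_self hη)
    filter_upwards [hmem h2.pos h2.le_nhds] with r hr using (h1 r hr).le
  refine ⟨δ, fun k => 1 - (x k).1 ^ 2, fun k => (x k).2.1, hδ', ?_, ?_, hv', fun G hG hGv => ?_⟩
  · filter_upwards [hx] with k h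
    have h1 := h.pos
    have h2 := h.le_one
    exact abs_le.2 ⟨by nlinarith, by nlinarith⟩
  · filter_upwards [hx] with k h
    refine h.degenerate.imp id fun h1 => ?_
    rw [h1]; norm_num
  obtain ⟨R₂, hR₂, hGan, h⟩ := exists_vanishing_along hgen hq hG hGv
  filter_upwards [h, hx, hsmall hR₂, hb.eventually (eventually_norm_lt hR₂),
    hv'.eventually (eventually_norm_lt hR₂)] with k h1 h2 h3 h4 h5
  have hnorm : ∀ r, |r| ≤ 1 → ‖shrink (t k, e k) r‖ < R₂ := fun r hr =>
    (norm_shrink_le _ hr).trans_lt h4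
  have h6 := h1 _ (shrink (t k, e k)) (x k).2.2.1 0 isOpen_Ioo isPreconnected_Ioo (h0J h2.pos)
    (fun r _ => analyticAt_shrink _ r) h2.analyticAt
    (fun r hr => max_lt (hnorm r ((abs_lt.2 hr).le.trans h2.le_one)) (h3 r hr))
    (shrink_zero _) h2.apply_zero h2.eval_eq_zero
  have h7 : AnalyticAt ℝ G (shrink (t k, e k) (x k).1, (x k).2.1) :=
    hGan _ (max_lt (hnorm _ (abs_le.2 ⟨by linarith [h2.pos], h2.le_one⟩)) h5)
  have h8 : Tendsto (fun r => (shrink (t k, e k) r, (x k).2.2.1 r)) (x k).2.2.2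
      (𝓝 (shrink (t k, e k) (x k).1, (x k).2.1)) :=
    ((analyticAt_shrink _ _).continuousAt.tendsto.mono_left
      (h2.le_nhds.trans nhdsWithin_le_nhds)).prodMk_nhds h2.tendsto
  refine tendsto_nhds_unique (h7.continuousAt.tendsto.comp h8) (tendsto_const_nhds.congr' ?_)
  filter_upwards [hmem h2.pos h2.le_nhds] with r hr using (h6 r hr).symm

end Degeneration

section Arc

open Polynomial

variable {E : Type*} [NormedAddCommGroup E] [NormedSpace ℝ E] {n : ℕ}
  {𝒰 : Ultrafilter ℕ} {t : ℕ → ℝ} {e : ℕ → E} {v : ℕ → Fin n → ℝ}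

/-- There is an analytic arc on which every analytic function vanishing along the sequence
vanishes. -/
def HasArc (𝒰 : Ultrafilter ℕ) (t : ℕ → ℝ) (v : ℕ → Fin n → ℝ) : Prop :=
  ∃ ε > 0, ∃ γ : ℝ → (Fin n → ℝ), (∀ s ∈ Set.Ioo 0 ε, AnalyticAt ℝ γ s) ∧
    Tendsto γ (𝓝[>] 0) (𝓝 0) ∧ ∀ g : ℝ × (Fin n → ℝ) → ℝ, AnalyticAt ℝ g 0 →
      (∀ᶠ k in (𝒰 : Filter ℕ), g (t k, v k) = 0) → ∀ᶠ s in 𝓝[>] (0 : ℝ), g (s, γ s) = 0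

theorem hasArc_of_subsingleton [Subsingleton E] {q : Fin n → (analyticRing (ℝ × E))[X]}
    (hgen : GenericSeq 𝒰 fun k => (t k, e k)) (hq : ∀ i, (q i).Monic)
    (hqv : ∀ i, ∀ᶠ k in (𝒰 : Filter ℕ), eval₂ (evHom (t k, e k)) (v k i) (q i) = 0)
    (ht : Tendsto t 𝒰 (𝓝 0)) (hpos : ∀ᶠ k in (𝒰 : Filter ℕ), 0 < t k) (hv : Tendsto v 𝒰 (𝓝 0)) :
    HasArc 𝒰 t v := by
  obtain ⟨s, δ, η, hη, R, hR, hδ, hsv, hδR, hnd⟩ := exists_nonDegenerate hgen hq hqv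
  have hb : ∀ k, (t k, e k) = (t k, (0 : E)) := fun k => by rw [Subsingleton.elim (e k) 0]
  have hnorm : ∀ r : ℝ, ‖(r, (0 : E))‖ = |r| := fun r => by simp
  have han : ∀ r : ℝ, AnalyticAt ℝ (fun r : ℝ => (r, (0 : E))) r := fun r =>
    analyticAt_prodMk_left _ _
  have hδ0 : AnalyticAt ℝ (fun r : ℝ => δ.1 (r, (0 : E))) 0 :=
    AnalyticAt.comp (f := fun r : ℝ => (r, (0 : E))) δ.2 (han 0)
  have hδ1 : ∀ᶠ r in 𝓝[≠] (0 : ℝ), δ.1 (r, (0 : E)) ≠ 0 := by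
    refine hδ0.eventually_eq_zero_or_eventually_ne_zero.resolve_left fun h => hδ ?_
    refine germHom_eq_zero_iff.2 ?_
    filter_upwards [ht.eventually h] with k hk
    rwa [hb]
  have hδ2 : ∀ᶠ r in 𝓝[>] (0 : ℝ), δ.1 (r, (0 : E)) ≠ 0 ∧ ‖r‖ < R :=
    (hδ1.filter_mono (nhdsWithin_mono _ fun y hy => ne_of_gt hy)).and
      ((eventually_norm_lt hR).filter_mono nhdsWithin_le_nhds)
  obtain ⟨ε, hε, hεs⟩ := mem_nhdsGT_iff_exists_Ioo_subset.1 hδ2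
  replace hε : 0 < ε := hε
  have hJ : ∀ r ∈ Set.Ioo 0 ε, AnalyticAt ℝ (fun r : ℝ => (r, (0 : E))) r ∧ ‖(r, (0 : E))‖ < R ∧
      δ.1 (r, (0 : E)) ≠ 0 := fun r hr => ⟨han r, by rw [hnorm]; exact (hεs hr).2, (hεs hr).1⟩
  have hbranch : ∀ᶠ k in (𝒰 : Filter ℕ), ∃ g : Fin n → ℝ → ℝ, t k ∈ Set.Ioo 0 ε ∧
      ∀ i, IsBranch (fun z => eval₂ (evHom (z.1, (0 : E))) z.2 (s i)) η (Set.Ioo 0 ε) (g i) ∧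
        g i (t k) = v k i := by
    filter_upwards [hpos, ht.eventually (eventually_lt_nhds hε),
      hv.eventually (eventually_norm_lt hη), eventually_all.2 hsv] with k h1 h2 h3 h4
    choose g hg using fun i => (hnd _ _ hJ i).1.exists_branch isOpen_Ioo isPreconnected_Ioo
      (s₀ := t k) (y₀ := v k i) ⟨h1, h2⟩ ((norm_le_pi_norm (v k) i).trans_lt h3)
      (by have := h4 i; rwa [hb] at this)
    exact ⟨g, ⟨h1, h2⟩, hg⟩
  obtain ⟨g, hg⟩ := hbranch.choice
  have hmid : ε / 2 ∈ Set.Ioo 0 ε := ⟨by linarith, by linarith⟩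
  let T : Set (Fin n → ℝ) := {y | ∀ i, y i ∈ {y | ((q i).map (evHom (ε / 2, (0 : E)))).IsRoot y}}
  have hT : T.Finite := Set.Finite.pi' fun i =>
    Polynomial.finite_setOfPred_isRoot ((hq i).map _).ne_zero
  have hTg : ⋃ c ∈ T, {k | (fun i => g k i (ε / 2)) = c} ∈ 𝒰 := by
    filter_upwards [hg] with k hk
    refine Set.mem_biUnion (x := fun i => g k i (ε / 2)) (fun i => ?_) rfl
    rw [Set.mem_ofPred_eq, IsRoot, eval_map]
    exact (hnd _ _ hJ i).2 _ hmid _ ((hk.2 i).1 _ hmid).2.1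
  obtain ⟨c, -, hc⟩ := (Ultrafilter.finite_biUnion_mem_iff hT).1 hTg
  replace hc : ∀ᶠ k in (𝒰 : Filter ℕ), (fun i => g k i (ε / 2)) = c := hc
  obtain ⟨k₀, hk₀, hck₀⟩ := (hg.and hc).exists
  have hvγ : ∀ᶠ k in (𝒰 : Filter ℕ), t k ∈ Set.Ioo 0 ε ∧ (fun i => g k₀ i (t k)) = v k := by
    filter_upwards [hg, hc] with k h1 h2
    refine ⟨h1.1, funext fun i => ?_⟩
    rw [← (h1.2 i).2]
    exact (hnd _ _ hJ i).1.eqOn isOpen_Ioo isPreconnected_Ioo subset_rfl (hk₀.2 i).1 (h1.2 i).1 hmid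
      (congrFun (hck₀.trans h2.symm) i) h1.1
  have hγ : ∀ r ∈ Set.Ioo 0 ε, AnalyticAt ℝ (fun r i => g k₀ i r) r := fun r hr =>
    AnalyticAt.pi fun i => ((hk₀.2 i).1 r hr).1
  have hγq : ∀ r ∈ Set.Ioo 0 ε, ∀ i, eval₂ (evHom (r, (0 : E))) (g k₀ i r) (q i) = 0 := fun r hr i =>
    (hnd _ _ hJ i).2 r hr _ ((hk₀.2 i).1 r hr).2.1
  have hlim : Tendsto (fun r i => g k₀ i r) (𝓝[>] 0) (𝓝 0) := by
    refine Metric.tendsto_nhds.2 fun η hη => ?_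
    obtain ⟨R', hR', h⟩ := exists_trap (B := ℝ × E) hq hv hη
    have hε' : 0 < min ε R' := lt_min hε hR'
    obtain ⟨k, h1, h2, h3⟩ := (h.and (hvγ.and (ht.eventually (eventually_lt_nhds hε')))).exists
    have hsub : Set.Ioo 0 (min ε R') ⊆ Set.Ioo 0 ε := Set.Ioo_subset_Ioo_right (min_le_left _ _)
    filter_upwards [Ioo_mem_nhdsGT hε'] with r hr
    rw [dist_zero_right]
    refine h1 (Set.Ioo 0 (min ε R')) (fun r => (r, 0)) (fun r i => g k₀ i r) (t k) isPreconnected_Ioo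
      ⟨h2.1.1, h3⟩ (fun r hr => (hγ r (hsub hr)).continuousAt.continuousWithinAt) (fun r hr => ?_) h2.2
      (fun r hr => hγq r (hsub hr)) r hr
    rw [hnorm, abs_of_pos hr.1]
    exact hr.2.trans_le (min_le_right _ _)
  refine ⟨ε, hε, _, hγ, hlim, fun f hf hfv => ?_⟩
  have hG : AnalyticAt ℝ (fun z : (ℝ × E) × (Fin n → ℝ) => f (z.1.1, z.2)) 0 := by
    have h1 : AnalyticAt ℝ (fun z : (ℝ × E) × (Fin n → ℝ) => (z.1.1, z.2)) 0 :=
      (((ContinuousLinearMap.fst ℝ ℝ E).comp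
        (ContinuousLinearMap.fst ℝ (ℝ × E) (Fin n → ℝ))).analyticAt 0).prod analyticAt_snd
    exact AnalyticAt.comp (f := fun z : (ℝ × E) × (Fin n → ℝ) => (z.1.1, z.2)) hf h1
  obtain ⟨R', hR', -, h⟩ := exists_vanishing_along hgen hq hG hfv
  have h1 : ∀ᶠ r in 𝓝[>] (0 : ℝ), ‖(r, (0 : E))‖ < R' ∧ ‖fun i => g k₀ i r‖ < R' := by
    refine Eventually.and ?_ (hlim.eventually (eventually_norm_lt hR'))
    simp only [hnorm]
    exact (eventually_norm_lt hR').filter_mono nhdsWithin_le_nhds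
  obtain ⟨ε', hε', hεs'⟩ := mem_nhdsGT_iff_exists_Ioo_subset.1 h1
  have hε'' : 0 < min ε ε' := lt_min hε hε'
  obtain ⟨k, h1, h2, h3⟩ := (h.and (hvγ.and (ht.eventually (eventually_lt_nhds hε'')))).exists
  have hsub : Set.Ioo 0 (min ε ε') ⊆ Set.Ioo 0 ε := Set.Ioo_subset_Ioo_right (min_le_left _ _)
  have hsub' : Set.Ioo 0 (min ε ε') ⊆ Set.Ioo 0 ε' := Set.Ioo_subset_Ioo_right (min_le_right _ _)
  filter_upwards [Ioo_mem_nhdsGT hε''] with r hr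
  exact h1 (Set.Ioo 0 (min ε ε')) (fun r => (r, 0)) (fun r i => g k₀ i r) (t k) isOpen_Ioo
    isPreconnected_Ioo ⟨h2.1.1, h3⟩ (fun r _ => han r) (fun r hr => hγ r (hsub hr))
    (fun r hr => max_lt (hεs' (hsub' hr)).1 (hεs' (hsub' hr)).2) (hb k).symm h2.2
    (fun r hr => hγq r (hsub hr)) r hr

end Arc

section Projection

open Polynomial

theorem integralAlong_analytic {B : Type*} [NormedAddCommGroup B] [NormedSpace ℝ B] {I : Type*}
    {l : Filter I} {b : I → B} {f : B → ℝ} (hf : AnalyticAt ℝ f 0) :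
    IntegralAlong l b fun k => f (b k) := by
  refine ⟨X - C ⟨f, hf⟩, monic_X_sub_C _, Eventually.of_forall fun z => ?_⟩
  rw [eval₂_sub, eval₂_X, eval₂_C]
  simp

theorem isIntegralElem_of_pow_eq {A L : Type*} [CommRing A] [CommRing L] (φ : A →+* L) {d : ℕ}
    {y : L} (r : ℕ → A) (h : y ^ d = ∑ j ∈ Finset.range d, φ (r j) * y ^ j) :
    φ.IsIntegralElem y := by
  refine ⟨X ^ d - ∑ j : Fin d, C (r j) * X ^ (j : ℕ),
    monic_X_pow_sub (degree_sum_fin_lt fun j : Fin d => r j), ?_⟩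
  simp only [eval₂_sub, eval₂_pow, eval₂_X, eval₂_finsetSum, eval₂_mul, eval₂_C]
  rw [h, Finset.sum_range, sub_self]

theorem integralAlong_of_eq_zero {B : Type*} [NormedAddCommGroup B] [NormedSpace ℝ B] {I : Type*}
    {l : Filter I} {b : I → B} {y : I → ℝ} {f : B × ℝ → ℝ} (hf : AnalyticAt ℝ f 0)
    (hf0 : ¬ ∀ᶠ y in 𝓝 (0 : ℝ), f (0, y) = 0) (hby : Tendsto (fun k => (b k, y k)) l (𝓝 0))
    (hz : ∀ᶠ k in l, f (b k, y k) = 0) {h : B × ℝ → ℝ} (hh : AnalyticAt ℝ h 0) :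
    IntegralAlong l b fun k => h (b k, y k) := by
  obtain ⟨d, hd⟩ := exists_division hf hf0
  have key : ∀ h : B × ℝ → ℝ, AnalyticAt ℝ h 0 → ∃ r : ℕ → analyticRing B,
      ((fun k => h (b k, y k) : I → ℝ) : Filter.Germ l ℝ) =
        ∑ j ∈ Finset.range d, germHom l b (r j) * (y : Filter.Germ l ℝ) ^ j := by
    intro h hh
    obtain ⟨r, hr, hrs⟩ := hd h hh
    have e := map_sum (Filter.Germ.coeRingHom (R := ℝ) l)
      (fun j => (fun k => r j (b k)) * y ^ j) (Finset.range d)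
    simp only [map_mul, map_pow] at e
    refine ⟨fun j => ⟨r j, hr j⟩, Eq.trans (Filter.Germ.coe_eq.2 ?_) e⟩
    filter_upwards [hby.eventually hrs, hz] with k h1 h2
    rw [h1 h2]
    simp
  have hy : (germHom l b).IsIntegralElem (y : Filter.Germ l ℝ) := by
    obtain ⟨r, hr⟩ := key (fun z => z.2 ^ d) (analyticAt_snd.fun_pow d)
    exact isIntegralElem_of_pow_eq _ r hr
  obtain ⟨r, hr⟩ := key h hh
  rw [integralAlong_iff, hr]
  let _ := (germHom l b).toAlgebra
  exact IsIntegral.sum _ fun j _ => IsIntegral.mul isIntegral_algebraMap (IsIntegral.pow hy j)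

variable {E : Type*} [NormedAddCommGroup E] [NormedSpace ℝ E]

theorem exists_direction {g : E → ℝ} (hg : AnalyticAt ℝ g 0) (h0 : ¬ ∀ᶠ x in 𝓝 0, g x = 0) :
    ∃ ω : E, ¬ ∀ᶠ y in 𝓝 (0 : ℝ), g (y • ω) = 0 := by
  by_contra! hcon
  obtain ⟨R, hR, h⟩ := Metric.eventually_nhds_iff_ball.1 hg.eventually_analyticAt
  refine h0 ?_
  filter_upwards [eventually_norm_lt hR] with x hx
  have han : AnalyticOnNhd ℝ (fun y : ℝ => g (y • x)) (Set.Icc 0 1) := fun y hy => by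
    refine AnalyticAt.comp (f := fun y : ℝ => y • x) (h _ ?_)
      (analyticAt_id.fun_smul analyticAt_const)
    rw [mem_ball_zero_iff, norm_smul, Real.norm_of_nonneg hy.1]
    nlinarith [hy.1, hy.2, norm_nonneg x]
  have := han.eqOn_zero_of_preconnected_of_eventuallyEq_zero isPreconnected_Icc
    (z₀ := 0) (by simp) (hcon x) (x := 1) (by simp)
  simpa using this

variable {𝒰 : Ultrafilter ℕ} {t : ℕ → ℝ} {e : ℕ → E}

theorem exists_factor_along (ht : Tendsto t 𝒰 (𝓝 0)) (he : Tendsto e 𝒰 (𝓝 0))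
    (hpos : ∀ᶠ k in (𝒰 : Filter ℕ), 0 < t k) {δ : analyticRing (ℝ × E)}
    (hδ : ∀ᶠ k in (𝒰 : Filter ℕ), δ.1 (t k, e k) = 0) (hδ0 : ¬ ∀ᶠ x in 𝓝 (0 : ℝ × E), δ.1 x = 0) :
    ∃ g : E × ℝ → ℝ, AnalyticAt ℝ g 0 ∧ (∀ᶠ k in (𝒰 : Filter ℕ), g (e k, t k) = 0) ∧
      ¬ ∀ᶠ x in 𝓝 (0 : E), g (x, 0) = 0 := by
  have h1 : AnalyticAt ℝ (fun z : E × ℝ => δ.1 (z.2, z.1)) 0 :=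
    AnalyticAt.comp (f := fun z : E × ℝ => (z.2, z.1)) δ.2 (analyticAt_snd.prod analyticAt_fst)
  have h2 : ¬ ∀ᶠ z in 𝓝 (0 : E × ℝ), δ.1 (z.2, z.1) = 0 := fun h =>
    hδ0 ((continuous_swap.tendsto' (0 : ℝ × E) (0 : E × ℝ) rfl).eventually h)
  obtain ⟨m, g, hg, hgm, hg0⟩ := exists_factor h1 h2
  refine ⟨g, hg, ?_, hg0⟩
  have h3 : Tendsto (fun k => (e k, t k)) 𝒰 (𝓝 0) := he.prodMk_nhds ht
  filter_upwards [h3.eventually hgm, hδ, hpos] with k h4 h5 h6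
  rw [h5] at h4
  exact (mul_eq_zero.1 h4.symm).resolve_left (pow_ne_zero _ (ne_of_gt h6))

/-- A sequence which is not generic is integral over its projection to a hyperplane. -/
theorem exists_integral_projection (ht : Tendsto t 𝒰 (𝓝 0)) (he : Tendsto e 𝒰 (𝓝 0))
    (hpos : ∀ᶠ k in (𝒰 : Filter ℕ), 0 < t k) (hgen : ¬ GenericSeq 𝒰 fun k => (t k, e k)) :
    ∃ (ℓ : E →L[ℝ] ℝ) (e' : ℕ → ℓ.ker), ℓ ≠ 0 ∧ Tendsto e' 𝒰 (𝓝 0) ∧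
      ∀ f : ℝ × E → ℝ, AnalyticAt ℝ f 0 →
        IntegralAlong 𝒰 (fun k => (t k, e' k)) fun k => f (t k, e k) := by
  simp only [GenericSeq, not_forall] at hgen
  obtain ⟨δ, hδ, hδ0⟩ := hgen
  obtain ⟨g, hg, hgz, hg0⟩ := exists_factor_along ht he hpos hδ hδ0
  have hg' : AnalyticAt ℝ (fun x : E => g (x, 0)) 0 :=
    AnalyticAt.comp (f := fun x : E => (x, (0 : ℝ))) hg (analyticAt_prodMk_left _ _)
  obtain ⟨ω, hω⟩ := exists_direction hg' hg0
  have hg00 : g 0 = 0 := by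
    have h1 : Tendsto (fun k => g (e k, t k)) 𝒰 (𝓝 (g 0)) :=
      hg.continuousAt.tendsto.comp (he.prodMk_nhds ht)
    exact tendsto_nhds_unique h1 (tendsto_const_nhds.congr' (hgz.mono fun k hk => hk.symm))
  have hω0 : ω ≠ 0 := by
    rintro rfl
    refine hω (Eventually.of_forall fun y => ?_)
    rw [smul_zero]; exact hg00
  obtain ⟨ℓ, hℓ⟩ := SeparatingDual.exists_eq_one (R := ℝ) hω0
  let e' : ℕ → ℓ.ker := fun k => ⟨e k - ℓ (e k) • ω, by simp [hℓ]⟩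
  have hℓe : Tendsto (fun k => ℓ (e k)) 𝒰 (𝓝 0) :=
    (ℓ.continuous.tendsto' 0 0 (map_zero ℓ)).comp he
  have he' : Tendsto e' 𝒰 (𝓝 0) := by
    refine tendsto_subtype_rng.2 ?_
    simpa using he.sub (hℓe.smul_const ω)
  refine ⟨ℓ, e', by rintro rfl; simp at hℓ, he', fun f hf => ?_⟩
  let Ψ : (ℝ × ℓ.ker) × ℝ →L[ℝ] ℝ × E :=
    ((ContinuousLinearMap.fst ℝ ℝ ℓ.ker).comp (ContinuousLinearMap.fst ℝ _ ℝ)).prod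
      ((ℓ.ker.subtypeL.comp ((ContinuousLinearMap.snd ℝ ℝ ℓ.ker).comp
        (ContinuousLinearMap.fst ℝ _ ℝ))) +
        (ContinuousLinearMap.snd ℝ (ℝ × ℓ.ker) ℝ).smulRight ω)
  have hΨ : ∀ t e y, Ψ ((t, e), y) = (t, (e : E) + y • ω) := fun t e y => rfl
  have hΨe : ∀ k, Ψ ((t k, e' k), ℓ (e k)) = (t k, e k) := fun k => by
    rw [hΨ]; simp [e']
  have hcomp : ∀ {f : ℝ × E → ℝ}, AnalyticAt ℝ f 0 → AnalyticAt ℝ (fun z => f (Ψ z)) 0 := by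
    intro f hf
    refine AnalyticAt.comp (f := Ψ) ?_ (Ψ.analyticAt 0)
    rw [map_zero]; exact hf
  have hswap : AnalyticAt ℝ (fun z : ℝ × E => g (z.2, z.1)) 0 :=
    AnalyticAt.comp (f := fun z : ℝ × E => (z.2, z.1)) hg (analyticAt_snd.prod analyticAt_fst)
  have := integralAlong_of_eq_zero (l := (𝒰 : Filter ℕ)) (b := fun k => (t k, e' k))
    (y := fun k => ℓ (e k)) (hcomp hswap) (fun h => hω ?_) ((ht.prodMk_nhds he').prodMk_nhds hℓe)
    ?_ (hcomp hf)
  · simpa only [hΨe] using this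
  · filter_upwards [h] with y hy
    have h1 : Ψ (0, y) = (0, y • ω) := by
      rw [← Prod.mk_zero_zero, hΨ]; simp
    rwa [h1] at hy
  · filter_upwards [hgz] with k hk
    rwa [hΨe]

end Projection

section Main

open Polynomial

theorem IntegralAlong.trans {B B' : Type*} [NormedAddCommGroup B] [NormedSpace ℝ B]
    [NormedAddCommGroup B'] [NormedSpace ℝ B'] {I : Type*} {l : Filter I} {b : I → B} {b' : I → B'}
    {v : I → ℝ} (hv : IntegralAlong l b v)
    (h : ∀ f : B → ℝ, AnalyticAt ℝ f 0 → IntegralAlong l b' fun k => f (b k)) :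
    IntegralAlong l b' v :=
  integralAlong_iff.2 (isIntegralElem_trans (germHom l b') (germHom l b)
    (fun f => integralAlong_iff.1 (h f.1 f.2)) (integralAlong_iff.1 hv))

variable {n : ℕ} {𝒰 : Ultrafilter ℕ}

theorem HasArc.of_vanishing {t : ℕ → ℝ} {v v' : ℕ → Fin n → ℝ} (h : HasArc 𝒰 t v')
    (hvv' : ∀ g : ℝ × (Fin n → ℝ) → ℝ, AnalyticAt ℝ g 0 →
      (∀ᶠ k in (𝒰 : Filter ℕ), g (t k, v k) = 0) → ∀ᶠ k in (𝒰 : Filter ℕ), g (t k, v' k) = 0) :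
    HasArc 𝒰 t v := by
  obtain ⟨ε, hε, γ, h1, h2, h3⟩ := h
  exact ⟨ε, hε, γ, h1, h2, fun g hg hgv => h3 g hg (hvv' g hg hgv)⟩

/-- Integral sequences over at most `d - 1` parameters, besides the time, have arcs. -/
def ArcsBelow (n : ℕ) (𝒰 : Ultrafilter ℕ) (d : ℕ) : Prop :=
  ∀ (E : Type) [NormedAddCommGroup E] [NormedSpace ℝ E] [FiniteDimensional ℝ E],
    Module.finrank ℝ E < d → ∀ (t : ℕ → ℝ) (e : ℕ → E) (v : ℕ → Fin n → ℝ),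
      Tendsto t 𝒰 (𝓝 0) → (∀ᶠ k in (𝒰 : Filter ℕ), 0 < t k) → Tendsto e 𝒰 (𝓝 0) →
      Tendsto v 𝒰 (𝓝 0) → (∀ i, IntegralAlong 𝒰 (fun k => (t k, e k)) fun k => v k i) →
      HasArc 𝒰 t v

variable {E : Type} [NormedAddCommGroup E] [NormedSpace ℝ E] [FiniteDimensional ℝ E]
  {t : ℕ → ℝ} {e : ℕ → E} {v : ℕ → Fin n → ℝ}

theorem ArcsBelow.hasArc_of_not_generic (H : ArcsBelow n 𝒰 (Module.finrank ℝ E))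
    (ht : Tendsto t 𝒰 (𝓝 0)) (hpos : ∀ᶠ k in (𝒰 : Filter ℕ), 0 < t k)
    (he : Tendsto e 𝒰 (𝓝 0)) (hv : Tendsto v 𝒰 (𝓝 0))
    (hvi : ∀ i, IntegralAlong 𝒰 (fun k => (t k, e k)) fun k => v k i)
    (hgen : ¬ GenericSeq 𝒰 fun k => (t k, e k)) : HasArc 𝒰 t v := by
  obtain ⟨ℓ, e', hℓ, he', h⟩ := exists_integral_projection ht he hpos hgen
  refine H ℓ.ker (Submodule.finrank_lt fun htop => hℓ ?_) t e' v ht hpos he' hv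
    fun i => (hvi i).trans h
  ext x
  have : x ∈ ℓ.ker := htop ▸ Submodule.mem_top
  exact this

theorem ArcsBelow.hasArc (H : ArcsBelow n 𝒰 (Module.finrank ℝ E))
    (ht : Tendsto t 𝒰 (𝓝 0)) (hpos : ∀ᶠ k in (𝒰 : Filter ℕ), 0 < t k)
    (he : Tendsto e 𝒰 (𝓝 0)) (hv : Tendsto v 𝒰 (𝓝 0))
    (hvi : ∀ i, IntegralAlong 𝒰 (fun k => (t k, e k)) fun k => v k i) : HasArc 𝒰 t v := by
  by_cases hgen : GenericSeq 𝒰 fun k => (t k, e k)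
  swap
  · exact H.hasArc_of_not_generic ht hpos he hv hvi hgen
  choose q hq hqv using hvi
  rcases subsingleton_or_nontrivial E with hE | hE
  · exact hasArc_of_subsingleton hgen hq hqv ht hpos hv
  obtain ⟨δ, c, v', hδ, hc1, hcδ, hv', hG⟩ := exists_degeneration hgen hq hqv ht he hv
  have hce : Tendsto (fun k => c k • e k) 𝒰 (𝓝 0) := by
    refine squeeze_zero_norm' (hc1.mono fun k hk => ?_) (tendsto_zero_iff_norm_tendsto_zero.1 he)
    rw [norm_smul, Real.norm_eq_abs]
    exact mul_le_of_le_one_left (norm_nonneg _) hk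
  refine HasArc.of_vanishing (v' := v') (H.hasArc_of_not_generic ht hpos hce hv' ?_ ?_) ?_
  · intro i
    refine ⟨q i, hq i, hG (fun z => eval₂ (evHom z.1) (z.2 i) (q i)) ?_ (hqv i)⟩
    let Λ : (ℝ × E) × (Fin n → ℝ) →L[ℝ] (ℝ × E) × ℝ :=
      (ContinuousLinearMap.fst ℝ _ _).prod
        ((ContinuousLinearMap.proj i).comp (ContinuousLinearMap.snd ℝ (ℝ × E) (Fin n → ℝ)))
    refine AnalyticAt.comp (f := Λ) (g := fun z => eval₂ (evHom z.1) z.2 (q i)) ?_ (Λ.analyticAt 0)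
    rw [map_zero]; exact analyticAt_eval₂_zero (q i) 0
  · obtain ⟨x, hx⟩ := exists_ne (0 : E)
    obtain ⟨ℓ, hℓ⟩ := SeparatingDual.exists_eq_one (R := ℝ) hx
    have hℓan : AnalyticAt ℝ (fun z : ℝ × E => ℓ z.2) 0 :=
      (ℓ.comp (ContinuousLinearMap.snd ℝ ℝ E)).analyticAt 0
    intro hgen'
    have h1 := hgen' ⟨fun z => δ.1 z * ℓ z.2, AnalyticAt.mul δ.2 hℓan⟩ (by
      filter_upwards [hcδ] with k hk
      rcases hk with hk | hk
      · simp [hk]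
      · simp [hk])
    have h2 : ∀ᶠ k in (𝒰 : Filter ℕ), δ.1 (t k, e k) = 0 ∨ ℓ (e k) = 0 := by
      filter_upwards [(show Tendsto (fun k => (t k, e k)) 𝒰 (𝓝 0) from
        ht.prodMk_nhds he).eventually h1] with k hk
      exact mul_eq_zero.1 hk
    have h3 := hgen ⟨_, hℓan⟩ ((Ultrafilter.eventually_or.1 h2).resolve_left hδ)
    have h4 : Tendsto (fun r : ℝ => ((0 : ℝ), r • x)) (𝓝[≠] 0) (𝓝 0) :=
      (Continuous.tendsto' (by fun_prop) _ _ (by simp)).mono_left nhdsWithin_le_nhds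
    obtain ⟨r, h5, h6⟩ := ((h4.eventually h3).and self_mem_nhdsWithin).exists
    refine h6 ?_
    simpa [hℓ] using h5
  · intro g hg hgv
    refine hG (fun z => g (z.1.1, z.2)) ?_ hgv
    let Λ : (ℝ × E) × (Fin n → ℝ) →L[ℝ] ℝ × (Fin n → ℝ) :=
      ((ContinuousLinearMap.fst ℝ ℝ E).comp (ContinuousLinearMap.fst ℝ _ _)).prod
        (ContinuousLinearMap.snd ℝ _ _)
    refine AnalyticAt.comp (f := Λ) (g := g) ?_ (Λ.analyticAt 0)
    rw [map_zero]; exact hg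

theorem arcsBelow (n : ℕ) (𝒰 : Ultrafilter ℕ) (d : ℕ) : ArcsBelow n 𝒰 d := by
  induction d with
  | zero => exact fun E _ _ _ h => absurd h (Nat.not_lt_zero _)
  | succ d ih =>
    intro E _ _ _ hd t e v ht hpos he hv hvi
    refine ArcsBelow.hasArc (e := e) (fun E' _ _ _ h' => ih E' ?_) ht hpos he hv hvi
    omega

theorem hasArc (ht : Tendsto t 𝒰 (𝓝 0)) (hpos : ∀ᶠ k in (𝒰 : Filter ℕ), 0 < t k)
    (hv : Tendsto v 𝒰 (𝓝 0)) : HasArc 𝒰 t v := by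
  refine arcsBelow n 𝒰 _ (Fin n → ℝ) (Nat.lt_succ_self _) t v v ht hpos hv hv fun i => ?_
  exact integralAlong_analytic (f := fun z : ℝ × (Fin n → ℝ) => z.2 i)
    (((ContinuousLinearMap.proj (R := ℝ) i).comp
      (ContinuousLinearMap.snd ℝ ℝ (Fin n → ℝ))).analyticAt 0)

end Main

section Curves

variable {n : ℕ} {X : Set (Fin n → ℝ)}

theorem mem_of_eventually_eq_zero {U : Set (Fin n → ℝ)} {F : Set ((Fin n → ℝ) → ℝ)}
    (hF : ∀ f ∈ F, ∀ x ∈ U, AnalyticAt ℝ f x) (hXU : X ∩ U = {x ∈ U | ∀ f ∈ F, f x = 0})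
    {ε : ℝ} (hε : 0 < ε) {c : ℝ → Fin n → ℝ} (hc : ∀ s ∈ Set.Ioo 0 ε, AnalyticAt ℝ c s)
    (hcU : ∀ s ∈ Set.Ioo 0 ε, c s ∈ U) (h : ∀ f ∈ F, ∀ᶠ s in 𝓝[>] (0 : ℝ), f (c s) = 0) :
    ∀ s ∈ Set.Ioo 0 ε, c s ∈ X := by
  intro s hs
  suffices c s ∈ X ∩ U from this.1
  rw [hXU]
  refine ⟨hcU s hs, fun f hf => ?_⟩
  have han : AnalyticOnNhd ℝ (fun s => f (c s)) (Set.Ioo 0 ε) := fun s hs =>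
    AnalyticAt.comp (f := c) (hF f hf _ (hcU s hs)) (hc s hs)
  obtain ⟨ε', hε', h0⟩ := mem_nhdsGT_iff_exists_Ioo_subset.1 (h f hf)
  have hpos : 0 < min ε ε' := lt_min hε hε'
  have hmid : min ε ε' / 2 ∈ Set.Ioo 0 (min ε ε') := ⟨half_pos hpos, half_lt_self hpos⟩
  refine han.eqOn_zero_of_preconnected_of_eventuallyEq_zero isPreconnected_Ioo
    (Set.Ioo_subset_Ioo_right (min_le_left _ _) hmid) ?_ hs
  filter_upwards [isOpen_Ioo.mem_nhds hmid] with r hr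
  exact h0 (Set.Ioo_subset_Ioo_right (min_le_right _ _) hr)

theorem analyticAt_secondOrder (u w : Fin n → ℝ) (z : ℝ × (Fin n → ℝ)) :
    AnalyticAt ℝ (fun z : ℝ × (Fin n → ℝ) =>
      z.1 • u + ((1 / 2 : ℝ) * z.1 ^ 2) • (w + z.2)) z :=
  (analyticAt_fst.fun_smul analyticAt_const).fun_add
    ((analyticAt_const.fun_mul (analyticAt_fst.fun_pow 2)).fun_smul
      (analyticAt_const.fun_add analyticAt_snd))

theorem exists_curve_of_mem_secondTangentSet (hX : IsRealAnalyticSet X)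
    (hX0 : (0 : Fin n → ℝ) ∈ X) {u w : Fin n → ℝ} (hw : w ∈ secondTangentSet X 0 u) :
    ∃ ε > (0 : ℝ), ∃ γ : ℝ → (Fin n → ℝ),
      (∀ t ∈ Set.Ioo (0 : ℝ) ε, AnalyticAt ℝ γ t) ∧ (∀ t ∈ Set.Ioo (0 : ℝ) ε, γ t ∈ X) ∧
      Tendsto (fun t : ℝ => (2 / t ^ 2) • (γ t - t • u)) (𝓝[>] (0 : ℝ)) (𝓝 w) := by
  obtain ⟨t, W, ht0, ht, hW, htX⟩ := hw
  obtain ⟨U, hU, h0U, F, hF, hXU⟩ := hX 0 hX0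
  have hle : ((hyperfilter ℕ : Ultrafilter ℕ) : Filter ℕ) ≤ atTop := by
    rw [← Nat.cofinite_eq_atTop]; exact hyperfilter_le_cofinite
  let v : ℕ → Fin n → ℝ := fun k => W k - w
  have hv : Tendsto v atTop (𝓝 0) := by simpa using hW.sub_const w
  obtain ⟨ε, hε, γ, hγ, hγ0, hγv⟩ := hasArc (𝒰 := hyperfilter ℕ) (ht.mono_left hle)
    (Eventually.of_forall ht0) (hv.mono_left hle)
  let c : ℝ × (Fin n → ℝ) → Fin n → ℝ := fun z =>
    z.1 • u + ((1 / 2 : ℝ) * z.1 ^ 2) • (w + z.2)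
  have hc : ∀ z, AnalyticAt ℝ c z := analyticAt_secondOrder u w
  have hc0 : c 0 = 0 := by simp [c]
  have hcU : ∀ᶠ z in 𝓝 0, c z ∈ U := (hc 0).continuousAt.eventually (by
    rw [hc0]; exact hU.mem_nhds h0U)
  have hvan : ∀ f ∈ F, ∀ᶠ s in 𝓝[>] (0 : ℝ), f (c (s, γ s)) = 0 := by
    intro f hf
    refine hγv (fun z => f (c z)) ?_ ?_
    · refine AnalyticAt.comp (f := c) ?_ (hc 0)
      rw [hc0]; exact hF f hf 0 h0U
    · refine hle ?_
      have h1 : Tendsto (fun k => (t k, v k)) atTop (𝓝 0) := ht.prodMk_nhds hv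
      filter_upwards [h1.eventually hcU] with k hk
      have h2 : c (t k, v k) ∈ X ∩ U := by
        refine ⟨?_, hk⟩
        have := htX k
        rw [zero_add] at this
        simpa only [c, v, add_sub_cancel] using this
      rw [hXU] at h2
      exact h2.2 f hf
  have h3 : Tendsto (fun s => (s, γ s)) (𝓝[>] 0) (𝓝 0) :=
    (tendsto_id.mono_left nhdsWithin_le_nhds).prodMk_nhds hγ0
  obtain ⟨ε', hε', h4⟩ := mem_nhdsGT_iff_exists_Ioo_subset.1 (h3.eventually hcU)
  have hpos : 0 < min ε ε' := lt_min hε hε'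
  have hcγ : ∀ s ∈ Set.Ioo 0 (min ε ε'), AnalyticAt ℝ (fun s => c (s, γ s)) s := fun s hs =>
    AnalyticAt.comp (f := fun s => (s, γ s)) (hc _)
      (analyticAt_id.prod (hγ s (Set.Ioo_subset_Ioo_right (min_le_left _ _) hs)))
  refine ⟨min ε ε', hpos, fun s => c (s, γ s), hcγ, mem_of_eventually_eq_zero hF hXU hpos hcγ
    (fun s hs => h4 (Set.Ioo_subset_Ioo_right (min_le_right _ _) hs)) hvan, ?_⟩
  have h5 : Tendsto (fun s => w + γ s) (𝓝[>] 0) (𝓝 w) := by simpa using hγ0.const_add w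
  refine h5.congr' ?_
  filter_upwards [self_mem_nhdsWithin] with s hs
  have hs0 : s ≠ 0 := ne_of_gt hs
  simp only [c, add_sub_cancel_left, smul_smul]
  rw [show 2 / s ^ 2 * (1 / 2 * s ^ 2) = 1 by field_simp, one_smul]

theorem mem_secondTangentSet_of_curve {u w : Fin n → ℝ} {ε : ℝ} (hε : 0 < ε)
    {γ : ℝ → (Fin n → ℝ)} (hγ : ∀ t ∈ Set.Ioo (0 : ℝ) ε, γ t ∈ X)
    (hlim : Tendsto (fun t : ℝ => (2 / t ^ 2) • (γ t - t • u)) (𝓝[>] (0 : ℝ)) (𝓝 w)) :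
    w ∈ secondTangentSet X 0 u := by
  have hpos : ∀ k : ℕ, 0 < ε / (k + 2) := fun k => by positivity
  have ht : Tendsto (fun k : ℕ => ε / ((k : ℝ) + 2)) atTop (𝓝 0) :=
    (tendsto_atTop_add_const_right _ _ tendsto_natCast_atTop_atTop).const_div_atTop ε
  refine ⟨fun k => ε / (k + 2), _, hpos, ht,
    hlim.comp (tendsto_nhdsWithin_iff.2 ⟨ht, Eventually.of_forall hpos⟩), fun k => ?_⟩
  have h0 := (hpos k).ne'
  have hlt : ε / (k + 2) < ε := div_lt_self hε (by have := k.cast_nonneg (α := ℝ); linarith)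
  simp only [Function.comp_apply, smul_smul]
  have h1 : ∀ x : ℝ, x ≠ 0 → 1 / 2 * x ^ 2 * (2 / x ^ 2) = 1 := fun x hx => by field_simp
  rw [h1 _ h0, one_smul, zero_add, add_sub_cancel]
  exact hγ _ ⟨hpos k, hlt⟩

end Curves

end RealAnalytic

/-- Analytic-arc characterization of the second-order tangent set of a
real analytic set: `w ∈ T²_{0,u} X` iff there is a real-analytic curve
`γ : (0, ε) → X` with `γ(t) = t u + (1/2) t² w + o(t²)` as `t → 0⁺`. -/
theorem stmt4 {n : ℕ} (X : Set (Fin n → ℝ)) (hX : IsRealAnalyticSet X)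
    (hX0 : (0 : Fin n → ℝ) ∈ X) (u : Fin n → ℝ) (hu : u ≠ 0) (w : Fin n → ℝ) :
    w ∈ secondTangentSet X 0 u ↔
      ∃ ε > (0 : ℝ), ∃ γ : ℝ → (Fin n → ℝ),
        (∀ t ∈ Set.Ioo (0 : ℝ) ε, AnalyticAt ℝ γ t) ∧
        (∀ t ∈ Set.Ioo (0 : ℝ) ε, γ t ∈ X) ∧
        Tendsto (fun t : ℝ => (2 / t ^ 2) • (γ t - t • u)) (𝓝[>] (0 : ℝ)) (𝓝 w) := by
  constructor
  · exact RealAnalytic.exists_curve_of_mem_secondTangentSet hX hX0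
  · rintro ⟨ε, hε, γ, -, hγ, hlim⟩
    exact RealAnalytic.mem_secondTangentSet_of_curve hε hγ hlim
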